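/- Let G be a 3-edge-connected graph with |V(G)| ≥ 4 and with at most one root vertex. Then G has no (rooted) immersion of K_4 if and only if either G is a doubled cycle, or G has a (2,2)-segmentation of width three. -/

import Mathlib

open scoped Classical

noncomputable section

namespace PaperW4

/-- A finite loopless undirected multigraph on ambient vertex type `V`:
a finite vertex set together with a multiset of (non-loop) edges supported on it. -/
structure MG (V : Type) where
  verts : Finset V
  edges : Multiset (Sym2 V)
  edge_support : ∀ e ∈ edges, ∀ v ∈ e, v ∈ verts
  loopless : ∀ e ∈ edges, ¬ e.IsDiag

variable {V : Type} {W : Type}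

/-- `δ_G(X)`: the edges of `G` with exactly one endpoint in `X`. -/
def cutEdges (G : MG V) (X : Finset V) : Multiset (Sym2 V) :=
  G.edges.filter fun e => ∃ u v, e = s(u, v) ∧ u ∈ X ∧ v ∉ X

/-- `d_G(X) = |δ_G(X)|`. -/
def dcut (G : MG V) (X : Finset V) : ℕ := (cutEdges G X).card

/-- The degree of a vertex: the number of edges incident with it. -/
def deg (G : MG V) (v : V) : ℕ := (G.edges.filter fun e => v ∈ e).card

/-- `e_G(u,v)`: the number of edges joining `u` and `v`. -/
def emult (G : MG V) (u v : V) : ℕ := G.edges.count s(u, v)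

/-- `G` is `k`-edge-connected: every edge-cut `δ(X)` with `∅ ≠ X ⊊ V(G)` has size `≥ k`. -/
def EdgeConn (G : MG V) (k : ℕ) : Prop :=
  ∀ X : Finset V, X ⊆ G.verts → X.Nonempty → X ≠ G.verts → k ≤ dcut G X

/-- `G` is internally `k`-edge-connected: every edge-cut with at least two vertices
on each side has size `≥ k`. -/
def InternallyEdgeConn (G : MG V) (k : ℕ) : Prop :=
  ∀ X : Finset V, X ⊆ G.verts → 2 ≤ X.card → 2 ≤ (G.verts \ X).card → k ≤ dcut G X

/-- Every vertex has degree three. -/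
def Cubic (G : MG V) : Prop := ∀ v ∈ G.verts, deg G v = 3

/-- The multiset of edges traversed by a walk, given as its list of vertices. -/
def walkEdges (l : List V) : Multiset (Sym2 V) :=
  (↑((l.zip l.tail).map fun p => s(p.1, p.2)) : Multiset (Sym2 V))

/-- `l` is (the vertex sequence of) a walk from `u` to `v`. -/
def IsWalk (l : List V) (u v : V) : Prop :=
  l.head? = some u ∧ l.getLast? = some v

/-- `G` is connected: any two of its vertices are joined by a trail in `G`. -/
def Connected (G : MG V) : Prop :=
  ∀ u ∈ G.verts, ∀ v ∈ G.verts,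
    ∃ l : List V, IsWalk l u v ∧ walkEdges l ≤ G.edges ∧ ∀ w ∈ l, w ∈ G.verts

/-- An immersion of the loopless multigraph with vertex type `W` and edge multiset `H`
into `G`, with terminal map `φ`: `φ` is injective, and to each edge `uv` of `H` is
assigned a walk in `G` from `φ u` to `φ v`, these walks being globally edge-disjoint. -/
def ImmersionVia (G : MG V) (H : Multiset (Sym2 W)) (φ : W → V) : Prop :=
  Function.Injective φ ∧ (∀ w : W, φ w ∈ G.verts) ∧
  ∃ P : Multiset (Sym2 W × List V),
    P.map Prod.fst = H ∧
    (∀ p ∈ P, ∃ u v : W, p.1 = s(u, v) ∧ IsWalk p.2 (φ u) (φ v)) ∧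
    (P.map fun p => walkEdges p.2).sum ≤ G.edges

/-- The edges of the wheel `W₄`: vertex `0` is the center, `1,2,3,4` the rim cycle. -/
def w4Edges : Multiset (Sym2 (Fin 5)) :=
  {s(0, 1), s(0, 2), s(0, 3), s(0, 4), s(1, 2), s(2, 3), s(3, 4), s(4, 1)}

/-- `G` has an immersion of `W₄`. -/
def HasW4Immersion (G : MG V) : Prop :=
  ∃ φ : Fin 5 → V, ImmersionVia G w4Edges φ

/-- `G` (rooted at `x`) has a rooted immersion of `W₄`: one in which the
center of `W₄` corresponds to `x`. -/
def HasRootedW4Immersion (G : MG V) (x : V) : Prop :=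
  ∃ φ : Fin 5 → V, φ 0 = x ∧ ImmersionVia G w4Edges φ

/-- The edges of `D_m`: roots are `0, 1`; vertices `2, 3` play the role of `y₀, y₁`;
there are `m - 2` parallel edges between the two roots. -/
def dmEdges (m : ℕ) : Multiset (Sym2 (Fin 4)) :=
  Multiset.replicate (m - 2) s(0, 1) + {s(0, 2), s(0, 3), s(1, 2), s(1, 3), s(2, 3)}

/-- `G` with roots `x0, x1` has a rooted immersion of `D_m`. -/
def HasRootedDmImmersion (G : MG V) (m : ℕ) (x0 x1 : V) : Prop :=
  ∃ φ : Fin 4 → V, φ 0 = x0 ∧ φ 1 = x1 ∧ ImmersionVia G (dmEdges m) φ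

/-- The edges of `K₄`. -/
def k4Edges : Multiset (Sym2 (Fin 4)) :=
  {s(0, 1), s(0, 2), s(0, 3), s(1, 2), s(1, 3), s(2, 3)}

/-- A nested chain of vertex sets `C 0 ⊂ C 1 ⊂ ⋯`, each obtained from the previous
by adding one vertex, all cuts having size exactly `k`. -/
def SegChain (G : MG V) (n : ℕ) (C : Fin (n + 1) → Finset V) (k : ℕ) : Prop :=
  (∀ i, C i ⊆ G.verts) ∧
  (∀ i : Fin n, C i.castSucc ⊆ C i.succ ∧ (C i.succ \ C i.castSucc).card = 1) ∧
  (∀ i, dcut G (C i) = k)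

/-- `G` has a segmentation of width `k` relative to `(X, Y)`. -/
def HasSegmentation (G : MG V) (X Y : Finset V) (k : ℕ) : Prop :=
  ∃ (n : ℕ) (C : Fin (n + 1) → Finset V),
    SegChain G n C k ∧ C 0 = X ∧ G.verts \ C (Fin.last n) = Y

/-- `λ_s(G) ≥ m`: every edge-cut separating `x0` from `x1` has size `≥ m`. -/
def LamSGe (G : MG V) (x0 x1 : V) (m : ℕ) : Prop :=
  ∀ X : Finset V, X ⊆ G.verts → x0 ∈ X → x1 ∉ X → m ≤ dcut G X

/-- `λ_n(G) ≥ m`: every edge-cut not separating `x0` from `x1` has size `≥ m`. -/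
def LamNGe (G : MG V) (x0 x1 : V) (m : ℕ) : Prop :=
  ∀ X : Finset V, X ⊆ G.verts → X.Nonempty → X ≠ G.verts →
    (x0 ∈ X ↔ x1 ∈ X) → m ≤ dcut G X

/-- `λ_n^i(G) ≥ m`: every internal edge-cut not separating `x0` from `x1` has size `≥ m`. -/
def LamNiGe (G : MG V) (x0 x1 : V) (m : ℕ) : Prop :=
  ∀ X : Finset V, X ⊆ G.verts → 2 ≤ X.card → 2 ≤ (G.verts \ X).card →
    (x0 ∈ X ↔ x1 ∈ X) → m ≤ dcut G X

/-- The subgraph of `G` induced on `S`. -/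
def induce (G : MG V) (S : Finset V) : MG V where
  verts := G.verts ∩ S
  edges := G.edges.filter fun e => ∀ v ∈ e, v ∈ S
  edge_support := by
    intro e he v hv
    rw [Multiset.mem_filter] at he
    exact Finset.mem_inter.mpr ⟨G.edge_support e he.1 v hv, he.2 v hv⟩
  loopless := fun e he => G.loopless e (Multiset.mem_of_mem_filter he)

/-- `G` with the vertices of `S` (and all incident edges) deleted. -/
def deleteVerts (G : MG V) (S : Finset V) : MG V := induce G (G.verts \ S)

/-- `C` is (the vertex set of) a connected component of `G`. -/
def IsComponent (G : MG V) (C : Finset V) : Prop :=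
  C ⊆ G.verts ∧ C.Nonempty ∧ Connected (induce G C) ∧
  ∀ e ∈ G.edges, (∃ v ∈ e, v ∈ C) → ∀ v ∈ e, v ∈ C

/-- `G` has type `A_m` with respect to roots `x0, x1`. -/
def TypeA (G : MG V) (m : ℕ) (x0 x1 : V) : Prop :=
  ∃ X0 X1 : Finset V, x0 ∈ X0 ∧ x1 ∈ X1 ∧ X0.card ≤ 2 ∧ X1.card ≤ 2 ∧
    HasSegmentation G X0 X1 m

/-- The edges of the lobe of `G` (with roots `x0, x1`) corresponding to the
component `C` of `G ∖ {x0, x1}`: edges inside `C ∪ {x0, x1}` other than `x0x1`-edges. -/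
def lobeEdges (G : MG V) (C : Finset V) (x0 x1 : V) : Multiset (Sym2 V) :=
  G.edges.filter fun e => (∀ v ∈ e, v ∈ insert x0 (insert x1 C)) ∧ e ≠ s(x0, x1)

/-- `G` has type `B_m` with respect to roots `x0, x1`. -/
def TypeB (G : MG V) (m : ℕ) (x0 x1 : V) : Prop :=
  ∃ (k : ℕ) (C : Fin k → Finset V) (nL : Fin k → ℕ),
    Function.Injective C ∧
    (∀ D : Finset V, IsComponent (deleteVerts G {x0, x1}) D ↔ ∃ i, C i = D) ∧
    (∀ i : Fin k, 2 ≤ nL i ∧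
      ∃ l : List V, l.Nodup ∧ IsWalk l x0 x1 ∧
        l.toFinset = insert x0 (insert x1 (C i)) ∧
        (2 ≤ (C i).card → nL i = 2) ∧
        lobeEdges G (C i) x0 x1 = nL i • walkEdges l) ∧
    emult G x0 x1 + ∑ i, nL i = m + 1

/-- The edge multiset of a cycle of length `n` on the vertices `f 0, f 1, …`. -/
def cycleEdges (n : ℕ) (f : Fin n → V) : Multiset (Sym2 V) :=
  (Finset.univ.val : Multiset (Fin n)).map fun i =>
    s(f i, f ⟨(i.val + 1) % n, Nat.mod_lt _ i.pos⟩)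

/-- `G` is a doubled cycle of length `n`. -/
def IsDoubledCycleLen (G : MG V) (n : ℕ) : Prop :=
  ∃ f : Fin n → V, Function.Injective f ∧ Finset.univ.image f = G.verts ∧
    G.edges = 2 • cycleEdges n f

/-- `G` is a doubled cycle. -/
def IsDoubledCycle (G : MG V) : Prop := ∃ n, 3 ≤ n ∧ IsDoubledCycleLen G n

/-- The map collapsing all of `Y` to the vertex `y0` and fixing everything else. -/
def collapseFun (Y : Finset V) (y0 : V) : V → V := fun v => if v ∈ Y then y0 else v

/-- The image multigraph of `G` under a vertex map `f` (identification of vertices),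
with any created loops deleted. -/
def mapGraph (f : V → V) (G : MG V) : MG V where
  verts := G.verts.image f
  edges := (G.edges.map (Sym2.map f)).filter fun e => ¬e.IsDiag
  edge_support := by
    intro e he v hv
    rw [Multiset.mem_filter] at he
    obtain ⟨he, -⟩ := he
    rw [Multiset.mem_map] at he
    obtain ⟨e', he', rfl⟩ := he
    rw [Sym2.mem_map] at hv
    obtain ⟨u, hu, rfl⟩ := hv
    exact Finset.mem_image_of_mem f (G.edge_support e' he' u hu)
  loopless := by
    intro e he
    rw [Multiset.mem_filter] at he
    exact he.2

/-- `G[X]` is a chain of sausages of order `k` in `G`: identifying `V(G) ∖ X` to a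
single vertex yields a doubled cycle of length `k + 1`. -/
def ChainOfSausages (G : MG V) (X : Finset V) (k : ℕ) : Prop :=
  X ⊆ G.verts ∧ X.card = k ∧ 2 ≤ k ∧
  ∃ y0 ∈ G.verts \ X,
    IsDoubledCycleLen (mapGraph (collapseFun (G.verts \ X) y0) G) (k + 1)

/-- `G` is sausage reduced: it has no chain of sausages of order at least `3`. -/
def SausageReduced (G : MG V) : Prop :=
  ¬ ∃ (X : Finset V) (k : ℕ), 3 ≤ k ∧ ChainOfSausages G X k

/-- One sausage shortening step of a rooted graph: two adjacent vertices of a chain of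
sausages of order at least three are identified, carrying the root along. -/
def RootedShortStep (p q : MG V × V) : Prop :=
  ∃ (X : Finset V) (k : ℕ) (a b : V),
    3 ≤ k ∧ ChainOfSausages p.1 X k ∧ a ∈ X ∧ b ∈ X ∧ a ≠ b ∧ s(a, b) ∈ p.1.edges ∧
    q.1 = mapGraph (fun v => if v = b then a else v) p.1 ∧
    q.2 = (if p.2 = b then a else p.2)

/-- Deleting a single copy of the edge `e` from `G`. -/
def deleteEdge (G : MG V) (e : Sym2 V) : MG V where
  verts := G.verts
  edges := G.edges.erase e
  edge_support := fun e' he' => G.edge_support e' (Multiset.mem_of_mem_erase he')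
  loopless := fun e' he' => G.loopless e' (Multiset.mem_of_mem_erase he')

/-- `G` has a tree-decomposition of width at most `k`. -/
def HasTreeDecomp (G : MG V) (k : ℕ) : Prop :=
  ∃ (ι : Type) (T : SimpleGraph ι) (B : ι → Finset V),
    T.IsTree ∧
    (∀ t, B t ⊆ G.verts) ∧
    (∀ v ∈ G.verts, ∃ t, v ∈ B t) ∧
    (∀ e ∈ G.edges, ∃ t, ∀ v ∈ e, v ∈ B t) ∧
    (∀ v ∈ G.verts, (SimpleGraph.induce {t | v ∈ B t} T).Connected) ∧
    ∀ t, (B t).card ≤ k + 1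

/-- The tree-width of `G`. -/
def treewidth (G : MG V) : ℕ := sInf { k | HasTreeDecomp G k }

/-- One subdivision step: an edge `uv` is replaced by a path `u - w - v`
through a new vertex `w`. -/
def SubdivStep (G H : MG V) : Prop :=
  ∃ u v w : V, s(u, v) ∈ G.edges ∧ w ∉ G.verts ∧
    H.verts = insert w G.verts ∧
    H.edges = (G.edges.erase s(u, v)) + {s(u, w), s(w, v)}

/-- `H` is a subdivision of `G`. -/
def IsSubdivision (G H : MG V) : Prop := Relation.ReflTransGen SubdivStep G H

/-- `G`, rooted at `u`, has type 2 (for the rooted `W₄` theorem). -/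
def TypeTwo (G : MG V) (u : V) : Prop :=
  ∃ W0 : Finset V, W0 ⊆ G.verts ∧ u ∉ W0 ∧ 1 ≤ W0.card ∧ W0.card ≤ 2 ∧
    ∃ w0 ∈ W0,
      ∃ n : ℕ, 3 ≤ n ∧
        ∃ f : Fin n → V,
          Function.Injective f ∧
          Finset.univ.image f = (mapGraph (collapseFun W0 w0) G).verts ∧
          (∃ i, f i = u) ∧ (∃ j, f j = w0) ∧
          ((s(u, w0) ∉ cycleEdges n f ∧
              (mapGraph (collapseFun W0 w0) G).edges =
                2 • cycleEdges n f + {s(u, w0)}) ∨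
           (∃ v : V, s(u, v) ∈ cycleEdges n f ∧ s(v, w0) ∈ cycleEdges n f ∧
              (mapGraph (collapseFun W0 w0) G).edges =
                2 • cycleEdges n f + {s(u, v), s(v, w0)}) ∨
           (s(u, w0) ∈ cycleEdges n f ∧
              (mapGraph (collapseFun W0 w0) G).edges =
                2 • cycleEdges n f + {s(u, w0)}))

/-! ### Counting edges across cuts -/

/-- The edge `e` has exactly one end in `X`. -/
def Crosses (X : Finset V) (e : Sym2 V) : Prop := ∃ u v, e = s(u, v) ∧ u ∈ X ∧ v ∉ X

theorem crosses_mk {X : Finset V} {a b : V} :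
    Crosses X s(a, b) ↔ (a ∈ X ∧ b ∉ X) ∨ (b ∈ X ∧ a ∉ X) := by
  constructor
  · rintro ⟨u, v, h, hu, hv⟩
    rcases Sym2.eq_iff.1 h with ⟨rfl, rfl⟩ | ⟨rfl, rfl⟩ <;> tauto
  · rintro (⟨ha, hb⟩ | ⟨hb, ha⟩)
    · exact ⟨a, b, rfl, ha, hb⟩
    · exact ⟨b, a, Sym2.eq_swap, hb, ha⟩

/-- The number of edges of the multiset `E` with exactly one end in `X`. -/
def cutCount (E : Multiset (Sym2 V)) (X : Finset V) : ℕ := E.countP (Crosses X)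

theorem dcut_eq_cutCount (G : MG V) (X : Finset V) : dcut G X = cutCount G.edges X := by
  rw [cutCount, Multiset.countP_eq_card_filter]; rfl

theorem countP_mono_of_imp {α : Type*} {E : Multiset α} {p q : α → Prop} [DecidablePred p]
    [DecidablePred q]
    (h : ∀ e ∈ E, p e → q e) : E.countP p ≤ E.countP q := by
  induction E using Multiset.induction_on with
  | empty => simp
  | cons e E ih =>
    have h1 := ih fun e he => h e (Multiset.mem_cons_of_mem he)
    have h2 := h e (Multiset.mem_cons_self e E)
    simp only [Multiset.countP_cons]
    split_ifs <;> first | omega | tauto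

theorem countP_add_le_add {α : Type*} {E : Multiset α} {p q r t : α → Prop} [DecidablePred p]
    [DecidablePred q] [DecidablePred r] [DecidablePred t]
    (h : ∀ e ∈ E, (if p e then 1 else 0) + (if q e then 1 else 0) ≤
      (if r e then 1 else 0) + (if t e then 1 else 0)) :
    E.countP p + E.countP q ≤ E.countP r + E.countP t := by
  induction E using Multiset.induction_on with
  | empty => simp
  | cons e E ih =>
    have h1 := ih fun e he => h e (Multiset.mem_cons_of_mem he)
    have h2 := h e (Multiset.mem_cons_self e E)
    simp only [Multiset.countP_cons]
    omega

theorem countP_le_add {α : Type*} {E : Multiset α} {p r t : α → Prop} [DecidablePred p]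
    [DecidablePred r] [DecidablePred t]
    (h : ∀ e ∈ E, p e → r e ∨ t e) : E.countP p ≤ E.countP r + E.countP t := by
  have := countP_add_le_add (E := E) (p := p) (q := fun _ => False) (r := r) (t := t) (by
    intro e he
    have := h e he
    by_cases hp : p e <;> by_cases hr : r e <;> by_cases ht : t e <;> simp_all)
  have h0 : E.countP (fun _ => False) = 0 := by simp
  omega

theorem exists_le_map_eq {α β : Type*} {f : α → β} {P : Multiset α} {D : Multiset β}
    (h : D ≤ P.map f) : ∃ Q ≤ P, Q.map f = D := by
  obtain ⟨R, hR⟩ := Multiset.le_iff_exists_add.1 h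
  clear h
  induction D using Multiset.induction_on generalizing P with
  | empty => exact ⟨0, Multiset.zero_le _, rfl⟩
  | cons d D ih =>
    rw [Multiset.cons_add] at hR
    obtain ⟨p, hp, rfl, hp'⟩ := (Multiset.map_eq_cons _ _ _ _).2 hR
    obtain ⟨Q, hQ, rfl⟩ := ih hp'
    exact ⟨p ::ₘ Q, by rw [← Multiset.cons_erase hp]; exact Multiset.cons_le_cons _ hQ, by simp⟩

theorem countP_eq_sub_add {α : Type*} [DecidableEq α] {E F : Multiset α} (h : F ≤ E) (p : α → Prop)
    [DecidablePred p] :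
    E.countP p = (E - F).countP p + F.countP p := by
  rw [← Multiset.countP_add, tsub_add_cancel_of_le h]

theorem cutCount_compl {E : Multiset (Sym2 V)} {U : Finset V} (hE : ∀ e ∈ E, ∀ v ∈ e, v ∈ U)
    (X : Finset V) : cutCount E (U \ X) = cutCount E X := by
  have key : ∀ e ∈ E, (Crosses (U \ X) e ↔ Crosses X e) := by
    intro e he
    have := hE e he
    induction e with
    | _ a b =>
      have ha := this a (by simp)
      have hb := this b (by simp)
      simp only [crosses_mk, Finset.mem_sdiff]
      tauto
  exact le_antisymm (countP_mono_of_imp fun e he => (key e he).1)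
    (countP_mono_of_imp fun e he => (key e he).2)

theorem cutCount_mono {E F : Multiset (Sym2 V)} (h : F ≤ E) (X : Finset V) :
    cutCount F X ≤ cutCount E X := Multiset.countP_le_of_le _ h

/-! ### Walks -/

theorem walkEdges_cons_cons (a b : V) (l : List V) :
    walkEdges (a :: b :: l) = s(a, b) ::ₘ walkEdges (b :: l) := rfl

theorem walkEdges_singleton (a : V) : walkEdges [a] = 0 := rfl

theorem walkEdges_append (l₁ l₂ : List V) (a : V) :
    walkEdges (l₁ ++ a :: l₂) = walkEdges (l₁ ++ [a]) + walkEdges (a :: l₂) := by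
  induction l₁ with
  | nil => simp [walkEdges_singleton]
  | cons b l ih =>
    cases l with
    | nil => simp [walkEdges_cons_cons, walkEdges_singleton]
    | cons c l => simpa [walkEdges_cons_cons] using ih

theorem walkEdges_reverse (l : List V) : walkEdges l.reverse = walkEdges l := by
  induction l with
  | nil => rfl
  | cons a l ih =>
    cases l with
    | nil => rfl
    | cons b l =>
      rw [List.reverse_cons, List.reverse_cons, List.append_assoc, List.singleton_append,
        walkEdges_append, ← List.reverse_cons, ih, walkEdges_cons_cons, walkEdges_cons_cons,
        walkEdges_singleton, Sym2.eq_swap, add_comm, Multiset.cons_add]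
      simp

theorem mem_of_mem_walkEdges {l : List V} {e : Sym2 V} (h : e ∈ walkEdges l) {v : V}
    (hv : v ∈ e) : v ∈ l := by
  induction l with
  | nil => simp [walkEdges] at h
  | cons a l ih =>
    cases l with
    | nil => simp [walkEdges_singleton] at h
    | cons b l =>
      rw [walkEdges_cons_cons, Multiset.mem_cons] at h
      rcases h with rfl | h
      · rcases Sym2.mem_iff.1 hv with rfl | rfl <;> simp
      · exact List.mem_cons_of_mem _ (ih h)

theorem IsWalk.reverse {l : List V} {u v : V} (h : IsWalk l u v) : IsWalk l.reverse v u := by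
  unfold IsWalk at *
  simp [h.1, h.2]

theorem IsWalk.exists_trans {l₁ l₂ : List V} {u v w : V} (h₁ : IsWalk l₁ u v)
    (h₂ : IsWalk l₂ v w) : ∃ l, IsWalk l u w ∧ walkEdges l = walkEdges l₁ + walkEdges l₂ := by
  obtain ⟨h1, h2⟩ := h₁
  obtain ⟨h3, h4⟩ := h₂
  obtain ⟨m, rfl⟩ := List.getLast?_eq_some_iff.1 h2
  obtain ⟨n, rfl⟩ := List.head?_eq_some_iff.1 h3
  refine ⟨m ++ v :: n, ⟨?_, ?_⟩, walkEdges_append m n v⟩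
  · cases m <;> simpa using h1
  · rw [List.getLast?_append, h4]; simp

/-! ### Routing one edge multiset through another -/

/-- `Route E D`: the edges in `D` can be realised by edge-disjoint walks in `E`; equivalently `D`
arises from `E` by deleting edges and splitting off (loops may be created and discarded). -/
inductive Route (E : Multiset (Sym2 V)) : Multiset (Sym2 V) → Prop
  | refl : Route E E
  | mono {D D' : Multiset (Sym2 V)} : Route E D → D' ≤ D → Route E D'
  | split {D : Multiset (Sym2 V)} (a b c : V) :
      Route E (s(a, b) ::ₘ s(b, c) ::ₘ D) → Route E (s(a, c) ::ₘ D)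
  | loop {D : Multiset (Sym2 V)} (a : V) : Route E D → Route E (s(a, a) ::ₘ D)

namespace Route

variable {E E' D D' F : Multiset (Sym2 V)}

theorem of_le (h : D ≤ E) : Route E D := refl.mono h

theorem trans (h : Route E D) (h' : Route D F) : Route E F := by
  induction h' with
  | refl => exact h
  | mono _ hle ih => exact ih.mono hle
  | split a b c _ ih => exact ih.split a b c
  | loop a _ ih => exact ih.loop a

theorem add_right (h : Route E D) (F : Multiset (Sym2 V)) : Route (E + F) (D + F) := by
  induction h with
  | refl => exact refl
  | mono _ hle ih => exact ih.mono (by gcongr)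
  | split a b c _ ih =>
    simp only [Multiset.cons_add] at ih ⊢
    exact ih.split a b c
  | loop a _ ih => simp only [Multiset.cons_add]; exact ih.loop a

theorem add (h : Route E D) (h' : Route E' D') : Route (E + E') (D + D') := by
  refine (h.add_right E').trans ?_
  rw [add_comm D, add_comm D]
  exact h'.add_right D

theorem of_le_left (h : E' ≤ E) (h' : Route E' D) : Route E D := (of_le h).trans h'

theorem pair (a b c : V) : Route {s(a, b), s(b, c)} {s(a, c)} :=
  split (D := 0) a b c refl

theorem walk (l : List V) (a b : V) (h : IsWalk l a b) : Route (walkEdges l) {s(a, b)} := by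
  obtain ⟨h1, h2⟩ := h
  induction l generalizing a with
  | nil => simp at h1
  | cons c l ih =>
    obtain rfl : c = a := by simpa using h1
    cases l with
    | nil =>
      obtain rfl : c = b := by simpa using h2
      exact (loop c refl).mono (by simp)
    | cons d l =>
      rw [walkEdges_cons_cons, ← Multiset.singleton_add]
      exact (refl.add (ih d (by simp) (by simpa using h2))).trans (pair c d b)

theorem exists_walks (h : Route E D) : ∃ P : Multiset (Sym2 V × List V), P.map Prod.fst = D ∧
    (∀ p ∈ P, ∃ u v, p.1 = s(u, v) ∧ IsWalk p.2 u v) ∧ (P.map fun p => walkEdges p.2).sum ≤ E := by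
  induction h with
  | refl =>
    refine ⟨E.map fun e => (e, [e.out.1, e.out.2]), by simp, ?_, ?_⟩
    · intro p hp
      obtain ⟨e, -, rfl⟩ := Multiset.mem_map.1 hp
      exact ⟨e.out.1, e.out.2, by simp [Sym2.mk], by simp [IsWalk]⟩
    · have : ∀ e : Sym2 V, walkEdges [e.out.1, e.out.2] = {e} := by
        intro e
        rw [walkEdges_cons_cons, walkEdges_singleton]
        simp [Sym2.mk]
      simp [Multiset.map_map, this]
  | mono _ hle ih =>
    obtain ⟨P, rfl, h2, h3⟩ := ih
    obtain ⟨Q, hQ, rfl⟩ := exists_le_map_eq hle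
    refine ⟨Q, rfl, fun p hp => h2 p (Multiset.mem_of_le hQ hp), le_trans ?_ h3⟩
    obtain ⟨R, rfl⟩ := Multiset.le_iff_exists_add.1 hQ
    simp
  | split a b c _ ih =>
    obtain ⟨P, h1, h2, h3⟩ := ih
    obtain ⟨p, hp, hpa, h1⟩ := (Multiset.map_eq_cons _ _ _ _).2 h1
    obtain ⟨q, hq, hqb, h1⟩ := (Multiset.map_eq_cons _ _ _ _).2 h1
    rw [← Multiset.cons_erase hp, ← Multiset.cons_erase hq] at h3
    have orient : ∀ r ∈ P, ∀ u v, r.1 = s(u, v) →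
        ∃ l, IsWalk l u v ∧ walkEdges l = walkEdges r.2 := by
      intro r hr u v huv
      obtain ⟨u', v', h, hw⟩ := h2 r hr
      rw [huv] at h
      rcases Sym2.eq_iff.1 h with ⟨rfl, rfl⟩ | ⟨rfl, rfl⟩
      · exact ⟨_, hw, rfl⟩
      · exact ⟨_, hw.reverse, walkEdges_reverse _⟩
    obtain ⟨l₁, w₁, e₁⟩ := orient p hp a b hpa
    obtain ⟨l₂, w₂, e₂⟩ := orient q (Multiset.mem_of_mem_erase hq) b c hqb
    obtain ⟨l, w, e⟩ := w₁.exists_trans w₂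
    refine ⟨(s(a, c), l) ::ₘ (P.erase p).erase q, by simp [h1], ?_, ?_⟩
    · intro r hr
      rcases Multiset.mem_cons.1 hr with rfl | hr
      · exact ⟨a, c, rfl, w⟩
      · exact h2 r (Multiset.mem_of_mem_erase (Multiset.mem_of_mem_erase hr))
    · simpa [e, e₁, e₂, add_assoc] using h3
  | loop a _ ih =>
    obtain ⟨P, h1, h2, h3⟩ := ih
    refine ⟨(s(a, a), [a]) ::ₘ P, by simp [h1], ?_, ?_⟩
    · intro r hr
      rcases Multiset.mem_cons.1 hr with rfl | hr
      · exact ⟨a, a, rfl, by simp [IsWalk]⟩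
      · exact h2 r hr
    · simpa [walkEdges_singleton] using h3

end Route

/-! ### Rooted immersions of `K₄` -/

/-- `G` has an immersion of `K₄` in which `x` is a terminal. -/
def HasK4At (G : MG V) (x : V) : Prop :=
  ∃ y₁ ∈ G.verts, ∃ y₂ ∈ G.verts, ∃ y₃ ∈ G.verts,
    x ≠ y₁ ∧ x ≠ y₂ ∧ x ≠ y₃ ∧ y₁ ≠ y₂ ∧ y₁ ≠ y₃ ∧ y₂ ≠ y₃ ∧
    Route G.edges {s(x, y₁), s(x, y₂), s(x, y₃), s(y₁, y₂), s(y₁, y₃), s(y₂, y₃)}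

theorem HasK4At.exists_immersionVia {G : MG V} {x : V} (hx : x ∈ G.verts) (h : HasK4At G x) :
    ∃ φ : Fin 4 → V, ImmersionVia G k4Edges φ ∧ φ 0 = x := by
  obtain ⟨y₁, h1, y₂, h2, y₃, h3, n1, n2, n3, n4, n5, n6, hr⟩ := h
  set φ : Fin 4 → V := ![x, y₁, y₂, y₃] with hφ
  have inj : Function.Injective φ := by
    intro i j hij
    fin_cases i <;> fin_cases j <;> simp_all [eq_comm]
  refine ⟨φ, ⟨inj, ?_, ?_⟩, rfl⟩
  · intro w; fin_cases w <;> simp_all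
  · obtain ⟨P, hP, hw, hs⟩ := hr.exists_walks
    have lift : ∀ (K : Multiset (Sym2 (Fin 4))) (P : Multiset (Sym2 V × List V)),
        P.map Prod.fst = K.map (Sym2.map φ) → ∃ Q : Multiset (Sym2 (Fin 4) × List V),
          Q.map Prod.fst = K ∧ Q.map (fun q => (Sym2.map φ q.1, q.2)) = P := by
      intro K
      induction K using Multiset.induction_on with
      | empty => intro P hP; exact ⟨0, rfl, by simpa [eq_comm] using hP⟩
      | cons k K ih =>
        intro P hP
        rw [Multiset.map_cons] at hP
        obtain ⟨p, hp, hpk, hP⟩ := (Multiset.map_eq_cons _ _ _ _).2 hP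
        obtain ⟨Q, hQ, hQ'⟩ := ih _ hP
        exact ⟨(k, p.2) ::ₘ Q, by simp [hQ], by simp [hQ', ← hpk, Multiset.cons_erase hp]⟩
    obtain ⟨Q, hQ, rfl⟩ := lift k4Edges P (by rw [hP]; simp [k4Edges, hφ])
    refine ⟨Q, hQ, ?_, by simpa [Multiset.map_map, Function.comp_def] using hs⟩
    intro q hq
    obtain ⟨u, v, huv, hwalk⟩ := hw _ (Multiset.mem_map_of_mem _ hq)
    obtain ⟨k, l⟩ := q
    induction k with
    | _ a b =>
      simp only [Sym2.map_mk] at huv hwalk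
      rcases Sym2.eq_iff.1 huv with ⟨rfl, rfl⟩ | ⟨rfl, rfl⟩
      · exact ⟨a, b, rfl, hwalk⟩
      · exact ⟨b, a, Sym2.eq_swap, hwalk⟩

/-! ### Integer flows and Menger's theorem -/

theorem exists_nodup_chain {α : Type*} {r : α → α → Prop} {a b : α}
    (h : Relation.ReflTransGen r a b) :
    ∃ l : List α, List.IsChain r (a :: l) ∧ (a :: l).Nodup ∧ (a :: l).getLast? = some b := by
  induction h using Relation.ReflTransGen.head_induction_on with
  | refl => exact ⟨[], by simp, by simp, by simp⟩
  | @head a c hac _ ih =>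
    obtain ⟨l, h1, h2, h3⟩ := ih
    by_cases ha : a ∈ c :: l
    · obtain ⟨s, t, hst⟩ := List.append_of_mem ha
      rw [hst] at h1 h2 h3
      exact ⟨t, h1.right_of_append, h2.of_append_right, by simpa using h3⟩
    · exact ⟨c :: l, List.isChain_cons_cons.2 ⟨hac, h1⟩, List.nodup_cons.2 ⟨ha, h2⟩,
        by simpa using h3⟩

/-- `f` is an integer flow in `E` (on the vertex set `U`) with net outflow `d`. -/
def IsFlow (E : Multiset (Sym2 V)) (U : Finset V) (f : V → V → ℤ) (d : V → ℤ) : Prop :=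
  (∀ u v, f u v = -f v u) ∧ (∀ u v, f u v ≤ E.count s(u, v)) ∧ ∀ v ∈ U, ∑ u ∈ U, f v u = d v

/-- The flow `f` with one more unit sent from `a` to `b`. -/
def pushUnit (f : V → V → ℤ) (a b : V) : V → V → ℤ := fun u v =>
  f u v + (if u = a ∧ v = b then 1 else 0) - (if u = b ∧ v = a then 1 else 0)

theorem sum_pushUnit {U : Finset V} {a b : V} (ha : a ∈ U) (hb : b ∈ U) (f : V → V → ℤ) (v : V) :
    ∑ u ∈ U, pushUnit f a b v u =
      ∑ u ∈ U, f v u + (if v = a then 1 else 0) - (if v = b then 1 else 0) := by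
  have h : ∀ p q : V, q ∈ U → ∑ u ∈ U, (if v = p ∧ u = q then (1 : ℤ) else 0) =
      if v = p then 1 else 0 := by
    intro p q hq
    by_cases hv : v = p <;> simp [hv, hq]
  simp only [pushUnit]
  rw [Finset.sum_sub_distrib, Finset.sum_add_distrib, h a b hb, h b a ha]

theorem pushUnit_antisymm {f : V → V → ℤ} (h : ∀ u v, f u v = -f v u) (a b u v : V) :
    pushUnit f a b u v = -pushUnit f a b v u := by
  simp only [pushUnit, h u v, and_comm]
  ring

theorem IsFlow.augment {E : Multiset (Sym2 V)} {U : Finset V} {f : V → V → ℤ} {d : V → ℤ}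
    (hf : IsFlow E U f d) (l : List V) (a b : V) (hU : ∀ v ∈ a :: l, v ∈ U)
    (hl : (a :: l).Nodup) (hr : List.IsChain (fun u v => f u v < E.count s(u, v)) (a :: l))
    (hb : (a :: l).getLast? = some b) :
    ∃ f', IsFlow E U f' (fun v => d v + (if v = a then 1 else 0) - (if v = b then 1 else 0)) ∧
      ∀ u v, ¬ (u ∈ a :: l ∧ v ∈ a :: l) → f' u v = f u v := by
  induction l generalizing a with
  | nil =>
    obtain rfl : a = b := by simpa using hb
    exact ⟨f, by simpa using hf, fun _ _ _ => rfl⟩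
  | cons c l ih =>
    rw [List.isChain_cons_cons] at hr
    rw [List.nodup_cons] at hl
    obtain ⟨f', ⟨h1, h2, h3⟩, h4⟩ := ih c (fun v hv => hU v (List.mem_cons_of_mem _ hv)) hl.2 hr.2
      (by simpa using hb)
    have hac : a ≠ c := by rintro rfl; simp at hl
    have e1 : f' a c = f a c := h4 _ _ fun h => hl.1 h.1
    refine ⟨pushUnit f' a c, ⟨pushUnit_antisymm h1 a c, ?_, ?_⟩, ?_⟩
    · intro u v
      have := h2 u v
      by_cases huv : u = a ∧ v = c
      · obtain ⟨rfl, rfl⟩ := huv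
        simp only [pushUnit, e1]
        have := hr.1
        simp [hac]
        omega
      · simp only [pushUnit, huv, if_false]
        split_ifs <;> omega
    · intro v hv
      rw [sum_pushUnit (hU a (by simp)) (hU c (by simp)), h3 v hv]
      ring
    · intro u v huv
      rw [pushUnit, h4 u v fun h => huv ⟨List.mem_cons_of_mem _ h.1, List.mem_cons_of_mem _ h.2⟩]
      have h5 : ¬ (u = a ∧ v = c) := by rintro ⟨rfl, rfl⟩; simp at huv
      have h6 : ¬ (u = c ∧ v = a) := by rintro ⟨rfl, rfl⟩; simp at huv
      simp [h5, h6]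

theorem cutCount_le_sum {E : Multiset (Sym2 V)} {U : Finset V} (hE : ∀ e ∈ E, ∀ v ∈ e, v ∈ U)
    (Z : Finset V) :
    (cutCount E Z : ℤ) ≤ ∑ v ∈ Z, ∑ u ∈ U \ Z, (E.count s(v, u) : ℤ) := by
  induction E using Multiset.induction_on with
  | empty => simp [cutCount]
  | cons e E ih =>
    have ih := ih fun e he => hE e (Multiset.mem_cons_of_mem he)
    have key : ((if Crosses Z e then 1 else 0 : ℕ) : ℤ) ≤
        ∑ v ∈ Z, ∑ u ∈ U \ Z, (if s(v, u) = e then 1 else 0 : ℤ) := by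
      split_ifs with h
      · obtain ⟨a, b, rfl, ha, hb⟩ := h
        have hb' : b ∈ U \ Z :=
          Finset.mem_sdiff.2 ⟨hE _ (Multiset.mem_cons_self _ _) b (by simp), hb⟩
        calc ((1 : ℕ) : ℤ) ≤ ∑ u ∈ U \ Z, (if s(a, u) = s(a, b) then 1 else 0 : ℤ) := by
              refine le_trans ?_ (Finset.single_le_sum (f := fun u =>
                (if s(a, u) = s(a, b) then 1 else 0 : ℤ)) (fun u _ => by positivity) hb')
              simp
          _ ≤ _ := Finset.single_le_sum (f := fun v => ∑ u ∈ U \ Z,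
                (if s(v, u) = s(a, b) then 1 else 0 : ℤ))
                (fun v _ => Finset.sum_nonneg fun u _ => by positivity) ha
      · exact_mod_cast Finset.sum_nonneg fun v _ => Finset.sum_nonneg fun u _ => by positivity
    rw [cutCount] at ih ⊢
    rw [Multiset.countP_cons]
    simp only [Multiset.count_cons, Nat.cast_add, Finset.sum_add_distrib]
    push_cast at *
    linarith

theorem sum_sum_antisymm (f : V → V → ℤ) (h : ∀ u v, f u v = -f v u) (Z : Finset V) :
    ∑ v ∈ Z, ∑ u ∈ Z, f v u = 0 := by
  have h1 : ∑ v ∈ Z, ∑ u ∈ Z, f v u = -∑ v ∈ Z, ∑ u ∈ Z, f v u := by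
    conv_lhs => rw [Finset.sum_comm]
    rw [← Finset.sum_neg_distrib]
    refine Finset.sum_congr rfl fun v _ => ?_
    rw [← Finset.sum_neg_distrib]
    exact Finset.sum_congr rfl fun u _ => h u v
  omega

theorem exists_flow {E : Multiset (Sym2 V)} {U : Finset V} (hE : ∀ e ∈ E, ∀ v ∈ e, v ∈ U)
    {x : V} (hx : x ∈ U) (c : V → ℕ) (k : ℕ)
    (h : ∀ X ⊆ U, x ∈ X → k ≤ cutCount E X + ∑ v ∈ X, c v) (j : ℕ) (hj : j ≤ k) :
    ∃ (f : V → V → ℤ) (M : Multiset V), M.card = j ∧ (∀ v, M.count v ≤ c v) ∧ (∀ v ∈ M, v ∈ U) ∧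
      IsFlow E U f fun v => (if v = x then (j : ℤ) else 0) - M.count v := by
  induction j with
  | zero =>
    refine ⟨fun _ _ => 0, 0, rfl, by simp, by simp, fun _ _ => by simp, fun _ _ => by simp,
      fun v _ => by simp⟩
  | succ j ih =>
    obtain ⟨f, M, hM, hc, hMU, hf⟩ := ih (by omega)
    set r : V → V → Prop := fun u v => f u v < E.count s(u, v) ∧ v ∈ U with hr
    set Z := U.filter fun v => Relation.ReflTransGen r x v with hZ
    by_cases hex : ∃ v ∈ Z, M.count v < c v
    · obtain ⟨v, hv, hvc⟩ := hex
      rw [hZ, Finset.mem_filter] at hv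
      obtain ⟨l, h1, h2, h3⟩ := exists_nodup_chain hv.2
      have hlU : ∀ w ∈ x :: l, w ∈ U := by
        intro w hw
        exact List.IsChain.induction (· ∈ U) _ h1 (fun _ _ h _ => h.2) (fun _ => by simpa using hx)
          w hw
      obtain ⟨f', hf', -⟩ := hf.augment l x v hlU h2 (h1.imp fun _ _ h => h.1) h3
      refine ⟨f', v ::ₘ M, by simp [hM], ?_, ?_, hf'.1, hf'.2.1, ?_⟩
      · intro w
        rw [Multiset.count_cons]
        have := hc w
        split_ifs with hwv
        · subst hwv; omega
        · omega
      · intro w hw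
        rcases Multiset.mem_cons.1 hw with rfl | hw
        · exact hv.1
        · exact hMU w hw
      · intro w hw
        rw [hf'.2.2 w hw]
        simp only [Multiset.count_cons]
        push_cast
        split_ifs <;> ring
    · exfalso
      push Not at hex
      obtain ⟨h1, h2, h3⟩ := hf
      have hxZ : x ∈ Z := Finset.mem_filter.2 ⟨hx, Relation.ReflTransGen.refl⟩
      have hZU : Z ⊆ U := Finset.filter_subset _ _
      have hk := h Z hZU hxZ
      have e1 : ∑ v ∈ Z, ∑ u ∈ U, f v u = j - ∑ v ∈ Z, (M.count v : ℤ) := by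
        rw [Finset.sum_congr rfl fun v hv => h3 v (hZU hv), Finset.sum_sub_distrib]
        simp [hxZ]
      have e2 : ∑ v ∈ Z, ∑ u ∈ U, f v u = ∑ v ∈ Z, ∑ u ∈ U \ Z, f v u := by
        have : ∀ v, ∑ u ∈ U, f v u = ∑ u ∈ U \ Z, f v u + ∑ u ∈ Z, f v u :=
          fun v => (Finset.sum_sdiff hZU).symm
        simp only [this, Finset.sum_add_distrib, sum_sum_antisymm f h1 Z, add_zero]
      have e3 : ∑ v ∈ Z, ∑ u ∈ U \ Z, (E.count s(v, u) : ℤ) ≤ ∑ v ∈ Z, ∑ u ∈ U \ Z, f v u := by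
        refine Finset.sum_le_sum fun v hv => Finset.sum_le_sum fun u hu => ?_
        by_contra! hlt
        rw [Finset.mem_sdiff] at hu
        exact hu.2 (Finset.mem_filter.2 ⟨hu.1, (Finset.mem_filter.1 hv).2.tail ⟨hlt, hu.1⟩⟩)
      have e4 := cutCount_le_sum hE Z
      have e5 : (∑ v ∈ Z, c v : ℤ) ≤ ∑ v ∈ Z, (M.count v : ℤ) :=
        Finset.sum_le_sum fun v hv => by exact_mod_cast hex v hv
      have hk' : (k : ℤ) ≤ cutCount E Z + ∑ v ∈ Z, (c v : ℤ) := by exact_mod_cast hk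
      omega

theorem IsFlow.route {E : Multiset (Sym2 V)} {U : Finset V} {x : V} {M : Multiset V}
    {f : V → V → ℤ} (hMU : ∀ v ∈ M, v ∈ U)
    (hf : IsFlow E U f fun v => (if v = x then (M.card : ℤ) else 0) - M.count v) :
    Route E (M.map fun v => s(x, v)) := by
  induction hn : E.card + M.card using Nat.strong_induction_on generalizing E M f with
  | _ n ih =>
    obtain ⟨h1, h2, h3⟩ := hf
    rcases M.empty_or_exists_mem with rfl | ⟨v, hv⟩
    · exact Route.of_le (Multiset.zero_le _)
    obtain ⟨M, rfl⟩ := Multiset.exists_cons_of_mem hv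
    have hvU := hMU v hv
    have hMU' : ∀ w ∈ M, w ∈ U := fun w hw => hMU w (Multiset.mem_cons_of_mem hw)
    rw [Multiset.map_cons]
    by_cases hvx : v = x
    · subst hvx
      refine Route.loop _ (ih _ ?_ hMU' ⟨h1, h2, fun w hw => ?_⟩ rfl)
      · rw [← hn]; simp
      · rw [h3 w hw]
        simp only [Multiset.count_cons, Multiset.card_cons]
        push_cast
        split_ifs <;> ring
    · obtain ⟨u, hu, huv⟩ : ∃ u ∈ U, f v u < 0 := by
        by_contra! hcon
        have := Finset.sum_nonneg hcon
        rw [h3 v hvU] at this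
        simp [hvx] at this
        omega
      have huv' : 0 < f u v := by rw [h1]; omega
      have hne : u ≠ v := by
        rintro rfl
        have := h1 u u
        omega
      have hmem : s(u, v) ∈ E := Multiset.count_pos.1 (by have := h2 u v; omega)
      obtain ⟨E', rfl⟩ := Multiset.exists_cons_of_mem hmem
      have key := ih (E'.card + (u ::ₘ M).card) (by rw [← hn]; simp) (E := E') (M := u ::ₘ M)
        (f := pushUnit f v u) (by
          intro w hw
          rcases Multiset.mem_cons.1 hw with rfl | hw
          · exact hu
          · exact hMU' w hw) ⟨pushUnit_antisymm h1 v u, ?_, ?_⟩ rfl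
      · rw [Multiset.map_cons] at key
        refine Route.split x u v ?_
        have := key.add_right {s(u, v)}
        rwa [add_comm, Multiset.singleton_add, add_comm, Multiset.singleton_add,
          Multiset.cons_swap] at this
      · intro a b
        have hab := h2 a b
        rw [Multiset.count_cons] at hab
        simp only [pushUnit]
        by_cases c1 : a = v ∧ b = u
        · obtain ⟨rfl, rfl⟩ := c1
          simp [hne.symm]
          omega
        · by_cases c2 : a = u ∧ b = v
          · obtain ⟨rfl, rfl⟩ := c2
            simp [hne] at hab ⊢
            omega
          · have : s(a, b) ≠ s(u, v) := by
              intro h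
              rcases Sym2.eq_iff.1 h with h | h <;> tauto
            simp [c1, c2, this] at hab ⊢
            omega
      · intro w hw
        rw [sum_pushUnit hvU hu, h3 w hw]
        simp only [Multiset.count_cons, Multiset.card_cons]
        push_cast
        split_ifs <;> ring

/-- Menger's theorem: if every vertex set `X` containing `x` satisfies `k ≤ |δ(X)| + c(X)`, there
are `k` edge-disjoint walks from `x` such that at most `c v` of them end at each vertex `v`. -/
theorem exists_route_of_cut {E : Multiset (Sym2 V)} {U : Finset V} (hE : ∀ e ∈ E, ∀ v ∈ e, v ∈ U)
    {x : V} (hx : x ∈ U) (c : V → ℕ) (k : ℕ)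
    (h : ∀ X ⊆ U, x ∈ X → k ≤ cutCount E X + ∑ v ∈ X, c v) :
    ∃ M : Multiset V, M.card = k ∧ (∀ v, M.count v ≤ c v) ∧ Route E (M.map fun v => s(x, v)) := by
  obtain ⟨f, M, rfl, hc, hMU, hf⟩ := exists_flow hE hx c k h k le_rfl
  exact ⟨M, rfl, hc, hf.route hMU⟩

/-! ### Cycles -/

theorem mem_edges_of_isChain {E : Multiset (Sym2 V)} {l : List V}
    (h : List.IsChain (fun u v => s(u, v) ∈ E) l) : ∀ e ∈ walkEdges l, e ∈ E := by
  induction l with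
  | nil => simp [walkEdges]
  | cons a l ih =>
    cases l with
    | nil => simp [walkEdges_singleton]
    | cons b l =>
      rw [List.isChain_cons_cons] at h
      intro e he
      rw [walkEdges_cons_cons, Multiset.mem_cons] at he
      rcases he with rfl | he
      · exact h.1
      · exact ih h.2 e he

theorem nodup_walkEdges {l : List V} (h : l.Nodup) : (walkEdges l).Nodup := by
  induction l with
  | nil => simp [walkEdges]
  | cons a l ih =>
    cases l with
    | nil => simp [walkEdges_singleton]
    | cons b l =>
      rw [List.nodup_cons] at h
      rw [walkEdges_cons_cons, Multiset.nodup_cons]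
      exact ⟨fun he => h.1 (mem_of_mem_walkEdges he (by simp)), ih h.2⟩

/-- The edges of the closed walk `c :: t ++ [c]`. -/
def closedEdges (c : V) (t : List V) : Multiset (Sym2 V) := walkEdges (c :: (t ++ [c]))

theorem closedEdges_rotate (c y : V) (a b : List V) :
    closedEdges c (a ++ y :: b) = closedEdges y (b ++ c :: a) := by
  have h1 := walkEdges_append (c :: a) (b ++ [c]) y
  have h2 := walkEdges_append (y :: b) (a ++ [y]) c
  simp only [closedEdges, List.append_assoc, List.cons_append] at *
  rw [h1, h2, add_comm]

theorem exists_rotate {c y : V} {t : List V} (hy : y ∈ c :: t) :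
    ∃ t', (y :: t').Perm (c :: t) ∧ closedEdges y t' = closedEdges c t := by
  rcases List.mem_cons.1 hy with rfl | hy
  · exact ⟨t, List.Perm.refl _, rfl⟩
  · obtain ⟨a, b, rfl⟩ := List.append_of_mem hy
    refine ⟨b ++ c :: a, ?_, (closedEdges_rotate c y a b).symm⟩
    have h1 : (y :: b ++ c :: a).Perm (c :: a ++ y :: b) := List.perm_append_comm
    simpa using h1

theorem exists_closedEdges_eq {c : V} {t : List V} (ht : 2 ≤ t.length) (hn : (c :: t).Nodup) :
    ∃ p q, p ≠ q ∧ p ∈ t ∧ q ∈ t ∧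
      closedEdges c t = s(c, p) ::ₘ s(c, q) ::ₘ walkEdges t := by
  match t, ht with
  | p :: r :: m, _ =>
    obtain ⟨n, q, hnq⟩ := List.eq_nil_or_concat (r :: m) |>.resolve_left (by simp)
    rw [hnq] at hn ⊢
    simp only [List.concat_eq_append] at *
    refine ⟨p, q, ?_, by simp, by simp, ?_⟩
    · rintro rfl; simp at hn
    · have := walkEdges_append (p :: n) [c] q
      simp only [closedEdges, List.cons_append, List.append_assoc] at *
      simp only [walkEdges_cons_cons, List.nil_append, this, walkEdges_singleton]
      rw [Sym2.eq_swap (a := q) (b := c), add_comm]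
      simp

theorem countP_mem_closedEdges {c : V} {t : List V} (ht : 2 ≤ t.length) (hn : (c :: t).Nodup)
    (v : V) : (closedEdges c t).countP (fun e => v ∈ e) = if v ∈ c :: t then 2 else 0 := by
  split_ifs with hv
  · obtain ⟨t', hp, he⟩ := exists_rotate hv
    have hn' := hp.nodup_iff.2 hn
    have hl := hp.length_eq
    simp only [List.length_cons] at hl
    obtain ⟨p, q, hpq, hpt, hqt, hE⟩ := exists_closedEdges_eq (by omega) hn'
    rw [← he, hE]
    have : (walkEdges t').countP (fun e => v ∈ e) = 0 := by
      rw [Multiset.countP_eq_zero]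
      exact fun e he hve => (List.nodup_cons.1 hn').1 (mem_of_mem_walkEdges he hve)
    simp [this]
  · rw [Multiset.countP_eq_zero]
    intro e he hve
    have := mem_of_mem_walkEdges he hve
    simp at this hv
    tauto

theorem nodup_closedEdges {c : V} {t : List V} (ht : 2 ≤ t.length) (hn : (c :: t).Nodup) :
    (closedEdges c t).Nodup := by
  obtain ⟨p, q, hpq, hpt, hqt, hE⟩ := exists_closedEdges_eq ht hn
  rw [List.nodup_cons] at hn
  rw [hE, Multiset.nodup_cons, Multiset.nodup_cons, Multiset.mem_cons]
  refine ⟨?_, fun h => hn.1 (mem_of_mem_walkEdges h (by simp)), nodup_walkEdges hn.2⟩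
  rintro (h | h)
  · rcases Sym2.eq_iff.1 h with h | h
    · exact hpq h.2
    · exact hn.1 (h.1 ▸ hqt)
  · exact hn.1 (mem_of_mem_walkEdges h (by simp))

theorem route_triangle {c : V} {t : List V} {y₁ y₂ y₃ : V} (h1 : y₁ ∈ c :: t) (h2 : y₂ ∈ c :: t)
    (h3 : y₃ ∈ c :: t) (h12 : y₁ ≠ y₂) (h13 : y₁ ≠ y₃) (h23 : y₂ ≠ y₃) :
    Route (closedEdges c t) {s(y₁, y₂), s(y₁, y₃), s(y₂, y₃)} := by
  have key : ∀ (y₁ y₂ y₃ : V) (a b d : List V),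
      Route (closedEdges y₁ (a ++ y₂ :: (b ++ y₃ :: d))) {s(y₁, y₂), s(y₁, y₃), s(y₂, y₃)} := by
    intro y₁ y₂ y₃ a b d
    have e1 := walkEdges_append (y₁ :: a) (b ++ y₃ :: (d ++ [y₁])) y₂
    have e2 := walkEdges_append (y₂ :: b) (d ++ [y₁]) y₃
    simp only [closedEdges, List.cons_append, List.append_assoc] at *
    rw [e1, e2]
    have r1 := Route.walk (y₁ :: (a ++ [y₂])) y₁ y₂ (by simp [IsWalk, List.getLast?_cons])
    have r2 := Route.walk (y₂ :: (b ++ [y₃])) y₂ y₃ (by simp [IsWalk, List.getLast?_cons])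
    have r3 := Route.walk (y₃ :: (d ++ [y₁])) y₃ y₁ (by simp [IsWalk, List.getLast?_cons])
    refine (r1.add (r2.add r3)).mono (le_of_eq ?_)
    rw [Sym2.eq_swap (a := y₃) (b := y₁), add_comm {s(y₂, y₃)}]
    rfl
  obtain ⟨t', hp, he⟩ := exists_rotate h1
  rw [← he]
  have h2' : y₂ ∈ t' := by simpa [h12.symm] using hp.mem_iff.2 h2
  have h3' : y₃ ∈ t' := by simpa [h13.symm] using hp.mem_iff.2 h3
  obtain ⟨a, b, rfl⟩ := List.append_of_mem h2'
  simp only [List.mem_append, List.mem_cons, h23.symm, false_or] at h3'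
  rcases h3' with h | h
  · obtain ⟨a, d, rfl⟩ := List.append_of_mem h
    have := key y₁ y₃ y₂ a d b
    simp only [List.append_assoc, List.cons_append]
    refine this.mono (le_of_eq ?_)
    rw [Sym2.eq_swap (a := y₂) (b := y₃)]
    exact Multiset.cons_swap _ _ _
  · obtain ⟨b, d, rfl⟩ := List.append_of_mem h
    exact key y₁ y₂ y₃ a b d

theorem cutCount_add_two_mul_countP {F : Multiset (Sym2 V)} (hF : ∀ e ∈ F, ¬ e.IsDiag)
    (X : Finset V) : cutCount F X + 2 * F.countP (fun e => ∀ v ∈ e, v ∈ X) =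
      ∑ v ∈ X, F.countP fun e => v ∈ e := by
  induction F using Multiset.induction_on with
  | empty => simp [cutCount]
  | cons e F ih =>
    have ih := ih fun e he => hF e (Multiset.mem_cons_of_mem he)
    have he := hF e (Multiset.mem_cons_self _ _)
    rw [cutCount] at *
    simp only [Multiset.countP_cons, Finset.sum_add_distrib, ← ih]
    have : (∑ v ∈ X, if v ∈ e then 1 else 0) =
        (if Crosses X e then 1 else 0) + 2 * if (∀ v ∈ e, v ∈ X) then 1 else 0 := by
      induction e with
      | _ a b =>
        have hab : a ≠ b := by simpa using he
        have h1 : (∑ v ∈ X, if v ∈ s(a, b) then 1 else 0) =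
            (∑ v ∈ X, if v = a then 1 else 0) + ∑ v ∈ X, if v = b then 1 else 0 := by
          rw [← Finset.sum_add_distrib]
          refine Finset.sum_congr rfl fun v _ => ?_
          simp only [Sym2.mem_iff]
          by_cases h : v = a <;> by_cases h' : v = b <;> simp_all
        rw [h1, Finset.sum_ite_eq', Finset.sum_ite_eq']
        simp only [crosses_mk, Sym2.mem_iff, forall_eq_or_imp, forall_eq]
        by_cases h : a ∈ X <;> by_cases h' : b ∈ X <;> simp [h, h']
    rw [this]
    ring

/-! ### Internally 4-edge-connected graphs -/

/-- `a` and `b` are joined by a walk with edges in `E` and vertices in `S`. -/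
def Reach (E : Multiset (Sym2 V)) (S : Finset V) : V → V → Prop :=
  Relation.ReflTransGen fun u v => s(u, v) ∈ E ∧ u ∈ S ∧ v ∈ S

theorem Reach.symm {E : Multiset (Sym2 V)} {S : Finset V} {a b : V} (h : Reach E S a b) :
    Reach E S b a :=
  by
  have : Std.Symm fun u v => s(u, v) ∈ E ∧ u ∈ S ∧ v ∈ S :=
    ⟨fun _ _ h => ⟨Sym2.eq_swap ▸ h.1, h.2.2, h.2.1⟩⟩
  exact Relation.ReflTransGen.stdSymm.symm _ _ h

theorem Reach.exists_path {E : Multiset (Sym2 V)} {S : Finset V} {a b : V} (h : Reach E S a b)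
    (ha : a ∈ S) : ∃ l : List V, (∀ e ∈ walkEdges (a :: l), e ∈ E) ∧ (∀ v ∈ a :: l, v ∈ S) ∧
      (a :: l).Nodup ∧ (a :: l).getLast? = some b := by
  obtain ⟨l, h1, h2, h3⟩ := exists_nodup_chain h
  exact ⟨l, mem_edges_of_isChain (h1.imp fun _ _ h => h.1),
    List.IsChain.induction (· ∈ S) _ h1 (fun _ _ h _ => h.2.2) (fun _ => by simpa using ha), h2, h3⟩

/-- The standing hypotheses on a graph with root `x` all of whose internal cuts have size at
least four. -/
structure InternalCore (G : MG V) (x : V) : Prop where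
  root : x ∈ G.verts
  three : ∀ X ⊆ G.verts, ∀ a ∈ X, ∀ b ∈ G.verts, b ∉ X → 3 ≤ cutCount G.edges X
  four : ∀ X ⊆ G.verts, 2 ≤ X.card → 2 ≤ (G.verts \ X).card → 4 ≤ cutCount G.edges X
  card : 4 ≤ G.verts.card

namespace InternalCore

variable {G : MG V} {x : V}

theorem reach_of_cutCount_le (hG : InternalCore G x) {Y : Finset V} (hY : Y ⊆ G.verts)
    {z : V} (hz : z ∈ G.verts) (hzY : z ∉ Y) (hd : cutCount G.edges Y ≤ 5) {p q : V} (hp : p ∈ Y)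
    (hq : q ∈ Y) : Reach G.edges Y p q := by
  by_contra hcon
  set A := Y.filter (Reach G.edges Y p) with hA
  have hpA : p ∈ A := Finset.mem_filter.2 ⟨hp, Relation.ReflTransGen.refl⟩
  have hAY : A ⊆ Y := Finset.filter_subset _ _
  have hqA : q ∉ A := fun h => hcon (Finset.mem_filter.1 h).2
  have closed : ∀ u v, s(u, v) ∈ G.edges → u ∈ A → v ∈ Y → v ∈ A := fun u v he hu hv =>
    Finset.mem_filter.2 ⟨hv, (Finset.mem_filter.1 hu).2.tail ⟨he, hAY hu, hv⟩⟩
  have h1 := hG.three A (hAY.trans hY) p hpA z hz fun h => hzY (hAY h)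
  have h2 := hG.three (Y \ A) (Finset.sdiff_subset.trans hY) q (Finset.mem_sdiff.2 ⟨hq, hqA⟩) z hz
    fun h => hzY (Finset.sdiff_subset h)
  have h3 : cutCount G.edges A + cutCount G.edges (Y \ A) ≤
      cutCount G.edges Y + G.edges.countP fun _ => False := by
    refine countP_add_le_add fun e he => ?_
    induction e with
    | _ a b =>
      have c1 := closed a b he
      have c2 := closed b a (Sym2.eq_swap ▸ he)
      have c3 := @hAY a
      have c4 := @hAY b
      simp only [crosses_mk, Finset.mem_sdiff]
      by_cases a1 : a ∈ A <;> by_cases b1 : b ∈ A <;> by_cases a2 : a ∈ Y <;>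
        by_cases b2 : b ∈ Y <;> simp_all
  have h0 : G.edges.countP (fun _ => False) = 0 := by simp
  omega

/-- A vertex set `X` containing the root and a vertex `c` which sends at least two of the at most
four edges leaving `X`. -/
structure Pinch (G : MG V) (x : V) (X : Finset V) (c : V) : Prop where
  subset : X ⊆ G.verts
  root_mem : x ∈ X
  mem : c ∈ X
  ne : c ≠ x
  nbrs : ∃ p q, p ≠ q ∧ p ∈ G.verts \ X ∧ q ∈ G.verts \ X ∧ s(c, p) ∈ G.edges ∧
    s(c, q) ∈ G.edges ∧ Reach G.edges (G.verts \ X) p q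
  count : G.edges.countP (fun e => Crosses X e ∧ c ∉ e) ≤ 2

theorem hasK4At_or_exists_pinch (hG : InternalCore G x) {c : V} {t : List V} (ht : 2 ≤ t.length)
    (hn : (c :: t).Nodup) (hx : x ∉ c :: t) (hE : closedEdges c t ≤ G.edges) :
    HasK4At G x ∨ ∃ X c₁ c₂, Pinch G x X c₁ ∧ c₁ ≠ c₂ ∧ c₁ ∈ X ∧ c₂ ∈ X ∧ c₁ ∈ c :: t ∧
      c₂ ∈ c :: t ∧ ∀ e ∈ G.edges, Crosses X e → ∀ v ∈ e, v ∈ c :: t := by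
  set F := closedEdges c t with hF
  set U := (c :: t).toFinset with hU
  have hUmem : ∀ v, v ∈ U ↔ v ∈ c :: t := fun v => List.mem_toFinset
  have hUcard : U.card = t.length + 1 := by
    rw [hU, List.toFinset_card_of_nodup hn, List.length_cons]
  have hUG : U ⊆ G.verts := by
    intro v hv
    have := countP_mem_closedEdges ht hn v
    rw [if_pos ((hUmem v).1 hv)] at this
    obtain ⟨e, he, hve⟩ := Multiset.countP_pos.1 (this ▸ Nat.two_pos)
    exact G.edge_support e (Multiset.mem_of_le hE he) v hve
  have hle : ∀ e ∈ G.edges - F, ∀ v ∈ e, v ∈ G.verts := fun e he =>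
    G.edge_support e (Multiset.mem_of_le tsub_le_self he)
  by_cases hcut : ∀ X ⊆ G.verts, x ∈ X →
      3 ≤ cutCount (G.edges - F) X + ∑ v ∈ X, if v ∈ U then 1 else 0
  · left
    obtain ⟨M, hM, hMc, hr⟩ := exists_route_of_cut hle hG.root (fun v => if v ∈ U then 1 else 0) 3
      hcut
    obtain ⟨y₁, y₂, y₃, rfl⟩ := Multiset.card_eq_three.1 hM
    have hnd : Multiset.Nodup {y₁, y₂, y₃} := by
      rw [Multiset.nodup_iff_count_le_one]
      intro v
      exact (hMc v).trans (by split_ifs <;> simp)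
    have hmem : ∀ v ∈ ({y₁, y₂, y₃} : Multiset V), v ∈ U := by
      intro v hv
      by_contra h
      have h1 := hMc v
      rw [if_neg h] at h1
      have := Multiset.count_pos.2 hv
      omega
    have m1 := hmem y₁ (by simp)
    have m2 := hmem y₂ (by simp)
    have m3 := hmem y₃ (by simp)
    simp at hnd
    have nx : ∀ y ∈ U, x ≠ y := by rintro y hy rfl; exact hx ((hUmem _).1 hy)
    refine ⟨y₁, hUG m1, y₂, hUG m2, y₃, hUG m3, nx _ m1, nx _ m2, nx _ m3, hnd.1.1, hnd.1.2,
      hnd.2, ?_⟩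
    have := hr.add (route_triangle ((hUmem _).1 m1) ((hUmem _).1 m2) ((hUmem _).1 m3) hnd.1.1
      hnd.1.2 hnd.2)
    rw [← hF, tsub_add_cancel_of_le hE] at this
    exact this
  · right
    push Not at hcut
    obtain ⟨X, hX, hxX, hlt⟩ := hcut
    have hsum : (∑ v ∈ X, if v ∈ U then 1 else 0) = (X ∩ U).card := by
      rw [← Finset.sum_filter, Finset.card_eq_sum_ones, Finset.filter_mem_eq_inter]
    have hdeg := cutCount_add_two_mul_countP
      (fun e he => G.loopless e (Multiset.mem_of_le hE he)) X
    simp only [hF, countP_mem_closedEdges ht hn, ← hUmem] at hdeg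
    have hsum2 : (∑ v ∈ X, if v ∈ U then 2 else 0) = 2 * (X ∩ U).card := by
      rw [← hsum, Finset.mul_sum]
      exact Finset.sum_congr rfl fun v _ => by split_ifs <;> rfl
    rw [hsum2] at hdeg
    rw [hsum] at hlt
    have hsplit : cutCount G.edges X = cutCount (G.edges - F) X + cutCount F X :=
      countP_eq_sub_add hE (Crosses X)
    rw [← hF] at hdeg
    have hUX : (U \ X).card + (X ∩ U).card = U.card := by
      rw [Finset.inter_comm]; exact Finset.card_sdiff_add_card_inter U X
    obtain ⟨z, hz⟩ : (U \ X).Nonempty := Finset.card_pos.1 (by omega)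
    rw [Finset.mem_sdiff] at hz
    have h3 := hG.three X hX x hxX z (hUG hz.1) hz.2
    have hxU : x ∉ U := fun h => hx ((hUmem x).1 h)
    have htwo : (X ∩ U).card = 2 := by
      by_contra hne
      have h4 := hG.four X hX
      rcases Nat.eq_zero_or_pos (X ∩ U).card with h0 | h0
      · omega
      · have c1 : (insert x (X ∩ U)).card ≤ X.card :=
          Finset.card_le_card (Finset.insert_subset hxX Finset.inter_subset_left)
        rw [Finset.card_insert_of_notMem (by simp [hxU])] at c1
        have c2 : (U \ X).card ≤ (G.verts \ X).card :=
          Finset.card_le_card (Finset.sdiff_subset_sdiff hUG le_rfl)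
        have := h4 (by omega) (by omega)
        omega
    obtain ⟨c₁, c₂, hc, hXU⟩ := Finset.card_eq_two.1 htwo
    have m1 : c₁ ∈ X ∩ U := by rw [hXU]; simp
    have m2 : c₂ ∈ X ∩ U := by rw [hXU]; simp
    rw [Finset.mem_inter] at m1 m2
    have hrest : cutCount (G.edges - F) X = 0 := by omega
    have hins : F.countP (fun e => ∀ v ∈ e, v ∈ X) = 0 := by omega
    have hcr : ∀ e ∈ G.edges, Crosses X e → ∀ v ∈ e, v ∈ c :: t := by
      intro e he hcr v hve
      have heF : e ∈ F := by
        by_contra h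
        have h1 : e ∈ G.edges - F := by
          rw [Multiset.mem_sub, Multiset.count_eq_zero_of_notMem h]
          exact Multiset.count_pos.2 he
        exact (Multiset.countP_eq_zero.1 hrest) e h1 hcr
      have := mem_of_mem_walkEdges heF hve
      simp only [List.mem_cons, List.mem_append, List.not_mem_nil, or_false] at this ⊢
      tauto
    refine ⟨X, c₁, c₂, ⟨hX, hxX, m1.1, ?_, ?_, ?_⟩, hc, m1.1, m2.1, (hUmem _).1 m1.2,
      (hUmem _).1 m2.2, hcr⟩
    · rintro rfl; exact hxU m1.2
    all_goals
      obtain ⟨t', hp, he⟩ := exists_rotate ((hUmem _).1 m1.2)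
      have hl := hp.length_eq
      simp only [List.length_cons] at hl
      obtain ⟨p, q, hpq, hpt, hqt, hEq⟩ := exists_closedEdges_eq (by omega) (hp.nodup_iff.2 hn)
      have hFeq : F = s(c₁, p) ::ₘ s(c₁, q) ::ₘ walkEdges t' := by rw [hF, ← he, hEq]
      have hpX : p ∉ X := fun h => Multiset.countP_eq_zero.1 hins s(c₁, p) (by simp [hFeq])
        (by simp [h, m1.1])
      have hqX : q ∉ X := fun h => Multiset.countP_eq_zero.1 hins s(c₁, q) (by simp [hFeq])
        (by simp [h, m1.1])
    · have hpU := hUG ((hUmem p).2 (hp.mem_iff.1 (List.mem_cons_of_mem _ hpt)))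
      have hqU := hUG ((hUmem q).2 (hp.mem_iff.1 (List.mem_cons_of_mem _ hqt)))
      refine ⟨p, q, hpq, by simp [hpX, hpU], by simp [hqX, hqU],
        Multiset.mem_of_le hE (by simp [hFeq]), Multiset.mem_of_le hE (by simp [hFeq]), ?_⟩
      refine hG.reach_of_cutCount_le Finset.sdiff_subset hG.root (by simp [hxX]) ?_
        (by simp [hpX, hpU]) (by simp [hqX, hqU])
      rw [cutCount_compl G.edge_support]
      omega
    · have e1 : G.edges.countP (fun e => Crosses X e ∧ c₁ ∉ e) +
          F.countP (fun e => Crosses X e ∧ c₁ ∈ e) ≤ cutCount G.edges X := by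
        refine le_trans (Nat.add_le_add_left (Multiset.countP_le_of_le _ hE) _) ?_
        have := countP_add_le_add (E := G.edges) (p := fun e => Crosses X e ∧ c₁ ∉ e)
          (q := fun e => Crosses X e ∧ c₁ ∈ e) (r := Crosses X) (t := fun _ => False)
          (by intro e _; by_cases h1 : Crosses X e <;> by_cases h2 : c₁ ∈ e <;> simp [h1, h2])
        simpa [cutCount] using this
      have e2 : 2 ≤ F.countP (fun e => Crosses X e ∧ c₁ ∈ e) := by
        rw [hFeq, Multiset.countP_cons, Multiset.countP_cons]
        simp [crosses_mk, m1.1, hpX, hqX]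
      omega

theorem closedEdges_le {E : Multiset (Sym2 V)} {c p q : V} {l : List V}
    (hE : ∀ e ∈ walkEdges (p :: l), e ∈ E) (hn : (c :: p :: l).Nodup)
    (hq : (p :: l).getLast? = some q) (hpq : p ≠ q) (hcp : s(c, p) ∈ E) (hcq : s(c, q) ∈ E) :
    2 ≤ (p :: l).length ∧ closedEdges c (p :: l) ≤ E := by
  have hl : 2 ≤ (p :: l).length := by
    cases l with
    | nil => simp at hq; exact absurd hq hpq
    | cons => simp
  refine ⟨hl, (Multiset.le_iff_subset (nodup_closedEdges hl hn)).2 fun e he => ?_⟩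
  obtain ⟨n, hnq⟩ := List.getLast?_eq_some_iff.1 hq
  have h1 : closedEdges c (p :: l) = s(c, p) ::ₘ walkEdges (p :: l ++ [c]) := rfl
  rw [h1, hnq, List.append_assoc, List.singleton_append, walkEdges_append, ← hnq,
    walkEdges_cons_cons, walkEdges_singleton] at he
  simp only [Multiset.mem_cons, Multiset.mem_add, Multiset.notMem_zero, or_false] at he
  rcases he with rfl | he | rfl
  · exact hcp
  · exact hE e he
  · rwa [Sym2.eq_swap]

theorem hasK4At_of_pinch (hG : InternalCore G x) {X : Finset V} {c : V} (h : Pinch G x X c) :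
    HasK4At G x := by
  induction hm : (G.verts \ X).card using Nat.strong_induction_on generalizing X c with
  | _ m ih =>
    obtain ⟨p, q, hpq, hp, hq, hcp, hcq, hr⟩ := h.nbrs
    obtain ⟨l, hl1, hl2, hl3, hl4⟩ := hr.exists_path hp
    have hcl : c ∉ p :: l := fun hc => (Finset.mem_sdiff.1 (hl2 c hc)).2 h.mem
    have hxl : x ∉ c :: p :: l := by
      rw [List.mem_cons, not_or]
      exact ⟨h.ne.symm, fun hc => (Finset.mem_sdiff.1 (hl2 x hc)).2 h.root_mem⟩
    have hn : (c :: p :: l).Nodup := List.nodup_cons.2 ⟨hcl, hl3⟩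
    obtain ⟨hlen, hle⟩ := closedEdges_le hl1 hn hl4 hpq hcp hcq
    rcases hG.hasK4At_or_exists_pinch hlen hn hxl hle with h' | ⟨X', c₁, c₂, h', hne, m1, m2, u1,
      u2, hcr⟩
    · exact h'
    have hcyc : ∀ v ∈ c :: p :: l, v ∈ X → v = c := by
      intro v hv hvX
      rcases List.mem_cons.1 hv with hv | hv
      · exact hv
      · exact absurd hvX (Finset.mem_sdiff.1 (hl2 v hv)).2
    have hpv : p ∈ G.verts ∧ p ∉ X := Finset.mem_sdiff.1 hp
    by_cases hcX' : c ∈ X'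
    · have hB : X ⊆ X' := by
        by_contra hcon
        obtain ⟨b, hb, hb'⟩ := Finset.not_subset.1 hcon
        have h3 := hG.three (X \ X') (Finset.sdiff_subset.trans h.subset) b (by simp [hb, hb']) p
          hpv.1 (by simp [hpv.2])
        have h4 : cutCount G.edges (X \ X') ≤ G.edges.countP (fun e => Crosses X e ∧ c ∉ e) := by
          refine countP_mono_of_imp fun e he => ?_
          rintro ⟨u, v, rfl, hu, hv⟩
          rw [Finset.mem_sdiff] at hu hv
          have hvX' : v ∉ X' := by
            intro hv'
            have := hcyc u (hcr _ he (crosses_mk.2 (Or.inr ⟨hv', hu.2⟩)) u (by simp)) hu.1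
            exact hu.2 (this ▸ hcX')
          have hvX : v ∉ X := fun h => hv ⟨h, hvX'⟩
          refine ⟨crosses_mk.2 (Or.inl ⟨hu.1, hvX⟩), ?_⟩
          rw [Sym2.mem_iff]
          rintro (rfl | rfl)
          · exact hu.2 hcX'
          · exact hvX' hcX'
        have := h.count
        omega
      refine ih _ ?_ h' rfl
      rw [← hm]
      refine Finset.card_lt_card ⟨Finset.sdiff_subset_sdiff le_rfl hB, fun hsub => ?_⟩
      obtain ⟨y, hy, hyX', hyc⟩ : ∃ y ∈ c :: p :: l, y ∈ X' ∧ y ≠ c := by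
        by_cases h1 : c₁ = c
        · exact ⟨c₂, u2, m2, fun h2 => hne (h1.trans h2.symm)⟩
        · exact ⟨c₁, u1, m1, h1⟩
      have hyX : y ∉ X := fun h => hyc (hcyc y hy h)
      exact (Finset.mem_sdiff.1 (hsub (Finset.mem_sdiff.2 ⟨h'.subset hyX', hyX⟩))).2 hyX'
    · exfalso
      have h3 := hG.three (X ∩ X') (Finset.inter_subset_left.trans h.subset) x
        (by simp [h.root_mem, h'.root_mem]) c (h.subset h.mem) (by simp [hcX'])
      have h4 : cutCount G.edges (X ∩ X') ≤ G.edges.countP (fun e => Crosses X e ∧ c ∉ e) := by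
        refine countP_mono_of_imp fun e he => ?_
        rintro ⟨u, v, rfl, hu, hv⟩
        rw [Finset.mem_inter] at hu hv
        have hvX' : v ∈ X' := by
          by_contra hv'
          have := hcyc u (hcr _ he (crosses_mk.2 (Or.inl ⟨hu.2, hv'⟩)) u (by simp)) hu.1
          exact hcX' (this ▸ hu.2)
        have hvX : v ∉ X := fun h => hv ⟨h, hvX'⟩
        refine ⟨crosses_mk.2 (Or.inl ⟨hu.1, hvX⟩), ?_⟩
        rw [Sym2.mem_iff]
        rintro (rfl | rfl)
        · exact hcX' hu.2
        · exact hcX' hvX'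
      have := h.count
      omega

theorem ne_of_mem_edges {G : MG V} {a b : V} (h : s(a, b) ∈ G.edges) : a ≠ b := by
  simpa using G.loopless _ h

theorem left_mem_of_mem_edges {G : MG V} {a b : V} (h : s(a, b) ∈ G.edges) : a ∈ G.verts :=
  G.edge_support _ h a (by simp)

theorem right_mem_of_mem_edges {G : MG V} {a b : V} (h : s(a, b) ∈ G.edges) : b ∈ G.verts :=
  G.edge_support _ h b (by simp)

/-- If two neighbours of `c` are joined by a path avoiding `c` and the root, there is a rooted
immersion of `K₄`. -/
theorem hasK4At_of_reach (hG : InternalCore G x) {c p q : V} (hcx : c ≠ x) (hpx : p ≠ x)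
    (hpq : p ≠ q) (hcp : s(c, p) ∈ G.edges) (hcq : s(c, q) ∈ G.edges)
    (hr : Reach G.edges (G.verts \ {x, c}) p q) : HasK4At G x := by
  have hp : p ∈ G.verts \ {x, c} := by
    simp [right_mem_of_mem_edges hcp, hpx, (ne_of_mem_edges hcp).symm]
  obtain ⟨l, hl1, hl2, hl3, hl4⟩ := hr.exists_path hp
  have hcl : c ∉ p :: l := fun hc => (Finset.mem_sdiff.1 (hl2 c hc)).2 (by simp)
  have hxl : x ∉ c :: p :: l := by
    rw [List.mem_cons, not_or]
    exact ⟨hcx.symm, fun hc => (Finset.mem_sdiff.1 (hl2 x hc)).2 (by simp)⟩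
  have hn : (c :: p :: l).Nodup := List.nodup_cons.2 ⟨hcl, hl3⟩
  obtain ⟨hlen, hle⟩ := closedEdges_le hl1 hn hl4 hpq hcp hcq
  rcases hG.hasK4At_or_exists_pinch hlen hn hxl hle with h' | ⟨X', c₁, c₂, h', -⟩
  · exact h'
  · exact hG.hasK4At_of_pinch h'

theorem sum_count_eq_countP (T : Multiset V) (X : Finset V) :
    ∑ v ∈ X, T.count v = T.countP (· ∈ X) := by
  induction T using Multiset.induction_on with
  | empty => simp
  | cons a T ih => simp [Multiset.count_cons, Multiset.countP_cons, Finset.sum_add_distrib, ih]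

/-- Menger's theorem with prescribed ends `T`. -/
theorem route_of_cut {E : Multiset (Sym2 V)} {U : Finset V} (hE : ∀ e ∈ E, ∀ v ∈ e, v ∈ U)
    {x : V} (hx : x ∈ U) (T : Multiset V)
    (h : ∀ X ⊆ U, x ∈ X → T.card ≤ cutCount E X + T.countP (· ∈ X)) :
    Route E (T.map fun v => s(x, v)) := by
  obtain ⟨M, hM, hc, hr⟩ := exists_route_of_cut hE hx (fun v => T.count v) T.card
    (fun X hX hxX => by rw [sum_count_eq_countP]; exact h X hX hxX)
  rwa [Multiset.eq_of_le_of_card_le (Multiset.le_iff_count.2 hc) hM.ge] at hr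

theorem countP_mem_replicate (n : ℕ) (a : V) (X : Finset V) :
    (Multiset.replicate n a).countP (· ∈ X) = if a ∈ X then n else 0 := by
  induction n with
  | zero => simp
  | succ n ih =>
    rw [Multiset.replicate_succ, Multiset.countP_cons, ih]
    split_ifs <;> rfl

theorem cutCount_le_of_separated {S X : Finset V} {p q : V} (hqS : q ∉ S)
    (hS : ∀ e ∈ G.edges, Crosses S e → x ∉ e → e = s(p, q)) (hX : X ⊆ insert x S) (hxX : x ∈ X) :
    cutCount G.edges (S \ X) ≤ cutCount (G.edges.filter fun e => ∀ v ∈ e, v ∈ insert x S) X +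
      if p ∈ X then 0 else G.edges.count s(p, q) := by
  rw [cutCount, cutCount, Multiset.countP_filter]
  have h1 : (if p ∈ X then 0 else G.edges.count s(p, q)) =
      G.edges.countP (fun e => s(p, q) = e ∧ p ∉ X) := by
    split_ifs with h <;> simp [h, Multiset.count]
  rw [h1]
  refine countP_le_add fun e he => ?_
  rintro ⟨u, v, rfl, hu, hv⟩
  rw [Finset.mem_sdiff] at hu hv
  by_cases hvS : v ∈ insert x S
  · left
    refine ⟨crosses_mk.2 (Or.inr ⟨?_, hu.2⟩), by simp [hu.1] at hvS ⊢; tauto⟩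
    rcases Finset.mem_insert.1 hvS with rfl | h
    · exact hxX
    · by_contra h'
      exact hv ⟨h, h'⟩
  · right
    rw [Finset.mem_insert, not_or] at hvS
    have hxe : x ∉ s(u, v) := by
      rw [Sym2.mem_iff]
      rintro (rfl | rfl)
      · exact hu.2 hxX
      · exact hvS.1 rfl
    have heq := hS _ he (crosses_mk.2 (Or.inl ⟨hu.1, hvS.2⟩)) hxe
    refine ⟨heq.symm, ?_⟩
    rcases Sym2.eq_iff.1 heq with ⟨rfl, rfl⟩ | ⟨rfl, rfl⟩
    · exact hu.2
    · exact absurd hu.1 hqS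

theorem hasK4At_of_separated (hG : InternalCore G x) {S : Finset V} {p z q : V}
    (hSG : S ⊆ G.verts) (hxS : x ∉ S) (hp : p ∈ S) (hz : z ∈ S) (hpz : s(p, z) ∈ G.edges)
    (hqG : q ∈ G.verts) (hqS : q ∉ S) (hqx : q ≠ x)
    (hS : ∀ e ∈ G.edges, Crosses S e → x ∉ e → e = s(p, q)) (hj : G.edges.count s(p, q) ≤ 1) :
    HasK4At G x := by
  set j := G.edges.count s(p, q) with hjdef
  set S' := G.verts \ insert x S with hS'
  have hqS' : q ∈ S' := by simp [hS', hqG, hqS, hqx]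
  have hxS' : x ∉ S' := by simp [hS']
  have hpS' : p ∉ S' := by simp [hS', hp]
  have hpzne := ne_of_mem_edges hpz
  have hcross : ∀ e ∈ G.edges, Crosses S' e → x ∉ e → e = s(q, p) := by
    rintro e he ⟨u, v, rfl, hu, hv⟩ hxe
    rw [Sym2.eq_swap (a := q)]
    refine hS _ he (crosses_mk.2 (Or.inr ⟨?_, fun h => ?_⟩)) hxe
    · have := right_mem_of_mem_edges he
      simp only [hS', Finset.mem_sdiff, Finset.mem_insert, Sym2.mem_iff] at *
      grind
    · simp [hS', h] at hu
  set E₁ := G.edges.filter fun e => ∀ v ∈ e, v ∈ insert x S with hE₁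
  set E₂ := G.edges.filter fun e => ∀ v ∈ e, v ∈ insert x S' with hE₂
  have hpzE₁ : s(p, z) ∈ E₁ := by
    rw [hE₁, Multiset.mem_filter]
    exact ⟨hpz, by simp [hp, hz]⟩
  have hE₁cons : E₁ = s(p, z) ::ₘ E₁.erase s(p, z) := (Multiset.cons_erase hpzE₁).symm
  have r1 : Route (E₁.erase s(p, z))
      ((Multiset.replicate (2 - j) p + Multiset.replicate 2 z).map fun v => s(x, v)) := by
    refine route_of_cut (U := insert x S) (fun e he => ?_) (Finset.mem_insert_self _ _) _
      fun X hX hxX => ?_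
    · exact (Multiset.mem_filter.1 (Multiset.mem_of_mem_erase he)).2
    · have h1 := cutCount_le_of_separated hqS hS hX hxX
      have h2 : cutCount E₁ X = cutCount (E₁.erase s(p, z)) X +
          if Crosses X s(p, z) then 1 else 0 := by
        conv_lhs => rw [hE₁cons]
        rw [cutCount, Multiset.countP_cons, cutCount]
      have h3 : ∀ a ∈ S, a ∉ X → 3 ≤ cutCount G.edges (S \ X) := fun a ha haX =>
        hG.three _ (Finset.sdiff_subset.trans hSG) a (by simp [ha, haX]) x hG.root (by simp [hxS])
      have h4 : p ∉ X → z ∉ X → 4 ≤ cutCount G.edges (S \ X) := by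
        intro hpX hzX
        refine hG.four _ (Finset.sdiff_subset.trans hSG) ?_ ?_
        · rw [← Finset.card_pair hpzne]
          exact Finset.card_le_card (by simp [Finset.insert_subset_iff, *])
        · rw [← Finset.card_pair hqx]
          exact Finset.card_le_card (by simp [Finset.insert_subset_iff, hqG, hqS, hxS, hG.root])
      have h5 := h3 p hp
      have h6 := h3 z hz
      rw [crosses_mk] at h2
      rw [← hE₁] at h1
      simp only [Multiset.card_add, Multiset.card_replicate, Multiset.countP_add,
        countP_mem_replicate]
      by_cases hpX : p ∈ X <;> by_cases hzX : z ∈ X <;> simp [hpX, hzX] at * <;> omega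
  have r2 : Route E₂ ((Multiset.replicate (3 - j) q).map fun v => s(x, v)) := by
    refine route_of_cut (U := insert x S') (fun e he => (Multiset.mem_filter.1 he).2)
      (Finset.mem_insert_self _ _) _ fun X hX hxX => ?_
    have h1 := cutCount_le_of_separated hpS' hcross hX hxX
    rw [Sym2.eq_swap, ← hjdef] at h1
    rw [Multiset.card_replicate]
    by_cases hqX : q ∈ X
    · simp [countP_mem_replicate, hqX]
    · have h3 := hG.three (S' \ X) (Finset.sdiff_subset.trans Finset.sdiff_subset) q
        (by simp [hqS', hqX]) x hG.root (by simp [hxS'])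
      rw [if_neg hqX] at h1
      omega
  have hle : E₁ + (E₂ + Multiset.replicate j s(p, q)) ≤ G.edges := by
    rw [Multiset.le_iff_count]
    intro e
    rw [Multiset.count_add, Multiset.count_add, hE₁, hE₂, Multiset.count_filter,
      Multiset.count_filter, Multiset.count_replicate]
    by_cases heq : s(p, q) = e
    · subst heq
      have n1 : ¬ ∀ v ∈ s(p, q), v ∈ insert x S := by simp [hqS, hqx]
      have n2 : ¬ ∀ v ∈ s(p, q), v ∈ insert x S' := by
        have : p ≠ x := by rintro rfl; exact hxS hp
        simp [hpS', this]
      rw [if_neg n1, if_neg n2]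
      simp [hjdef]
    · rw [if_neg heq]
      by_cases he : e ∈ G.edges
      · have : ¬ ((∀ v ∈ e, v ∈ insert x S) ∧ (∀ v ∈ e, v ∈ insert x S')) := by
          rintro ⟨h1, h2⟩
          have h3 : ∀ v ∈ e, v = x := by
            intro v hv
            have a1 := h1 v hv
            have a2 := h2 v hv
            simp only [hS', Finset.mem_insert, Finset.mem_sdiff] at a1 a2
            tauto
          refine G.loopless e he ?_
          induction e with
          | _ a b => simp [h3 a (by simp), h3 b (by simp)]
        split_ifs <;> first | omega | tauto
      · simp [Multiset.count_eq_zero_of_notMem he]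
  have hr : Route G.edges (s(p, z) ::ₘ
      ((Multiset.replicate (2 - j) p + Multiset.replicate 2 z).map fun v => s(x, v)) +
      ((Multiset.replicate (3 - j) q).map (fun v => s(x, v)) + Multiset.replicate j s(p, q))) := by
    refine Route.of_le_left hle (Route.add ?_ (r2.add_right _))
    rw [hE₁cons, ← Multiset.singleton_add, ← Multiset.singleton_add]
    exact Route.refl.add r1
  have hxp : x ≠ p := by rintro rfl; exact hxS hp
  have hxz : x ≠ z := by rintro rfl; exact hxS hz
  have hpq : p ≠ q := by rintro rfl; exact hqS hp
  have hzq : z ≠ q := by rintro rfl; exact hqS hz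
  refine ⟨p, hSG hp, z, hSG hz, q, hqG, hxp, hxz, hqx.symm, hpzne, hpq, hzq, hr.trans ?_⟩
  have key : Route ({s(z, x), s(x, q)} : Multiset (Sym2 V)) {s(z, q)} := Route.pair z x q
  rcases Nat.le_one_iff_eq_zero_or_eq_one.1 hj with h0 | h0
  · rw [h0]
    have key2 : Route ({s(p, x), s(x, q)} : Multiset (Sym2 V)) {s(p, q)} := Route.pair p x q
    have := (key.add key2).add_right {s(x, p), s(x, z), s(x, q), s(p, z)}
    rw [Sym2.eq_swap (a := z) (b := x), Sym2.eq_swap (a := p) (b := x)] at this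
    refine (Route.of_le (le_of_eq ?_)).trans (this.mono (le_of_eq ?_)) <;>
    · simp [Multiset.replicate_succ, ← Multiset.singleton_add]
      abel
  · rw [h0]
    have := key.add_right {s(x, p), s(x, z), s(x, q), s(p, z), s(p, q)}
    rw [Sym2.eq_swap (a := z) (b := x)] at this
    refine (Route.of_le (le_of_eq ?_)).trans (this.mono (le_of_eq ?_)) <;>
    · simp [Multiset.replicate_succ, ← Multiset.singleton_add]
      try abel

theorem mem_edges_swap {E : Multiset (Sym2 V)} {a b : V} (h : s(a, b) ∈ E) : s(b, a) ∈ E := by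
  rwa [Sym2.eq_swap]

theorem hasK4At_of_star (hG : InternalCore G x) (h : ∀ e ∈ G.edges, x ∈ e) : HasK4At G x := by
  have h3 : 3 ≤ (G.verts.erase x).card := by
    rw [Finset.card_erase_of_mem hG.root]
    have := hG.card
    omega
  obtain ⟨T, hT, hT3⟩ := Finset.exists_subset_card_eq h3
  obtain ⟨y₁, y₂, y₃, n12, n13, n23, rfl⟩ := Finset.card_eq_three.1 hT3
  have hy : ∀ y ∈ ({y₁, y₂, y₃} : Finset V), x ≠ y ∧ y ∈ G.verts ∧ 3 ≤ G.edges.count s(x, y) := by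
    intro y hy
    have h1 := Finset.mem_erase.1 (hT hy)
    refine ⟨h1.1.symm, h1.2, ?_⟩
    refine (hG.three {y} (by simpa using h1.2) y (by simp) x hG.root
      (by simpa using h1.1.symm)).trans ?_
    rw [Multiset.count, cutCount]
    refine countP_mono_of_imp fun e he => ?_
    rintro ⟨u, v, rfl, hu, hv⟩
    obtain rfl : u = y := by simpa using hu
    rcases Sym2.mem_iff.1 (h _ he) with rfl | rfl
    · exact absurd rfl h1.1
    · exact Sym2.eq_swap
  obtain ⟨x1, v1, c1⟩ := hy y₁ (by simp)
  obtain ⟨x2, v2, c2⟩ := hy y₂ (by simp)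
  obtain ⟨x3, v3, c3⟩ := hy y₃ (by simp)
  refine ⟨y₁, v1, y₂, v2, y₃, v3, x1, x2, x3, n12, n13, n23, ?_⟩
  have hle : Multiset.replicate 3 s(x, y₁) + (Multiset.replicate 3 s(x, y₂) +
      Multiset.replicate 3 s(x, y₃)) ≤ G.edges := by
    rw [Multiset.le_iff_count]
    intro e
    simp only [Multiset.count_add, Multiset.count_replicate]
    have e12 : s(x, y₁) ≠ s(x, y₂) := by rwa [Ne, Sym2.congr_right]
    have e13 : s(x, y₁) ≠ s(x, y₃) := by rwa [Ne, Sym2.congr_right]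
    have e23 : s(x, y₂) ≠ s(x, y₃) := by rwa [Ne, Sym2.congr_right]
    by_cases h1 : s(x, y₁) = e
    · subst h1; simp [e12.symm, e13.symm, c1]
    · by_cases h2 : s(x, y₂) = e
      · subst h2; simp [e12, e23.symm, c2]
      · by_cases h3 : s(x, y₃) = e
        · subst h3; simp [e13, e23, c3]
        · simp [h1, h2, h3]
  refine Route.of_le_left hle ?_
  have := (((Route.pair y₁ x y₂).add (Route.pair y₁ x y₃)).add (Route.pair y₂ x y₃)).add_right
    {s(x, y₁), s(x, y₂), s(x, y₃)}
  rw [Sym2.eq_swap (a := y₁) (b := x), Sym2.eq_swap (a := y₂) (b := x)] at this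
  refine (Route.of_le (le_of_eq ?_)).trans (this.mono (le_of_eq ?_)) <;>
  · simp [Multiset.replicate_succ, ← Multiset.singleton_add]
    abel

theorem reach_of_not_hasK4At (hG : InternalCore G x) (hK : ¬ HasK4At G x) {p q : V}
    (hp : p ∈ G.verts) (hpx : p ≠ x) (hq : q ∈ G.verts) (hqx : q ≠ x) :
    Reach G.edges (G.verts.erase x) p q := by
  obtain ⟨e, he, hxe⟩ : ∃ e ∈ G.edges, x ∉ e := by
    by_contra! h
    exact hK (hG.hasK4At_of_star h)
  induction e with
  | _ a b =>
    rw [Sym2.mem_iff, not_or] at hxe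
    have haG := left_mem_of_mem_edges he
    have hbG := right_mem_of_mem_edges he
    have key : ∀ w ∈ G.verts, w ≠ x → Reach G.edges (G.verts.erase x) a w := by
      intro w hw hwx
      by_contra hcon
      set S := (G.verts.erase x).filter (Reach G.edges (G.verts.erase x) a) with hS
      have hSsub : S ⊆ G.verts.erase x := Finset.filter_subset _ _
      have closed : ∀ u v, s(u, v) ∈ G.edges → u ∈ S → v ≠ x → v ∈ S := by
        intro u v huv hu hv
        have h1 : v ∈ G.verts.erase x := Finset.mem_erase.2 ⟨hv, right_mem_of_mem_edges huv⟩
        exact Finset.mem_filter.2 ⟨h1, (Finset.mem_filter.1 hu).2.tail ⟨huv, hSsub hu, h1⟩⟩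
      have haS : a ∈ S := Finset.mem_filter.2
        ⟨Finset.mem_erase.2 ⟨fun h => hxe.1 h.symm, haG⟩, Relation.ReflTransGen.refl⟩
      have hwS : w ∉ S := fun h => hcon (Finset.mem_filter.1 h).2
      refine hK (hG.hasK4At_of_separated (S := S) (p := a) (z := b) (q := w)
        (hSsub.trans (Finset.erase_subset _ _)) (fun h => by simpa using hSsub h) haS
        (closed a b he haS fun h => hxe.2 h.symm) he hw hwS hwx ?_ ?_)
      · rintro e he ⟨u, v, rfl, hu, hv⟩ hx
        exact absurd (closed u v he hu fun h => hx (by simp [h])) hv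
      · rw [Multiset.count_eq_zero_of_notMem fun h => hwS (closed a w h haS hwx)]
        exact Nat.zero_le _
    exact (key p hp hpx).symm.trans (key q hq hqx)

theorem two_le_count (hG : InternalCore G x) (hK : ¬ HasK4At G x) {p q r : V} (hpx : p ≠ x)
    (hqx : q ≠ x) (hrx : r ≠ x) (hqr : q ≠ r) (hpq : s(p, q) ∈ G.edges)
    (hpr : s(p, r) ∈ G.edges) : 2 ≤ G.edges.count s(p, q) := by
  by_contra hcount
  refine hK ?_
  set C := (G.verts \ {x, p}).filter (Reach G.edges (G.verts \ {x, p}) q) with hC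
  have hCsub : C ⊆ G.verts \ {x, p} := Finset.filter_subset _ _
  have hqC : q ∈ C := Finset.mem_filter.2
    ⟨by simp [hqx, right_mem_of_mem_edges hpq, (ne_of_mem_edges hpq).symm], .refl⟩
  have closed : ∀ u v, s(u, v) ∈ G.edges → u ∈ C → v ≠ x → v ≠ p → v ∈ C := by
    intro u v huv hu hv hvp
    have h1 : v ∈ G.verts \ {x, p} := by simp [right_mem_of_mem_edges huv, hv, hvp]
    exact Finset.mem_filter.2 ⟨h1, (Finset.mem_filter.1 hu).2.tail ⟨huv, hCsub hu, h1⟩⟩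
  have unique : ∀ v ∈ C, s(p, v) ∈ G.edges → v = q := by
    intro v hv hpv
    by_contra hne
    exact hK (hG.hasK4At_of_reach hpx hqx (fun h => hne h.symm) hpq hpv (Finset.mem_filter.1 hv).2)
  have hxC : x ∉ C := fun h => by simpa using hCsub h
  have hpC : p ∉ C := fun h => by simpa using hCsub h
  refine hG.hasK4At_of_separated (S := (G.verts.erase x) \ C) (p := p) (z := r) (q := q)
    (Finset.sdiff_subset.trans (Finset.erase_subset _ _)) (by simp)
    (by simp [hpx, hpC, left_mem_of_mem_edges hpq]) ?_ hpr (right_mem_of_mem_edges hpq)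
    (by simp [hqC]) hqx ?_ (by omega)
  · simp only [Finset.mem_sdiff, Finset.mem_erase]
    exact ⟨⟨hrx, right_mem_of_mem_edges hpr⟩, fun h => hqr (unique r h hpr).symm⟩
  · rintro e he ⟨u, v, rfl, hu, hv⟩ hxe
    rw [Sym2.mem_iff, not_or] at hxe
    simp only [Finset.mem_sdiff, Finset.mem_erase] at hu hv
    have hvC : v ∈ C := by
      by_contra h
      exact hv ⟨⟨fun h => hxe.2 h.symm, right_mem_of_mem_edges he⟩, h⟩
    have hup : u = p := by
      by_contra h
      exact hu.2 (closed v u (mem_edges_swap he) hvC hu.1.1 h)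
    subst hup
    rw [unique v hvC he]

theorem reach_mono {E : Multiset (Sym2 V)} {S T : Finset V} (h : S ⊆ T) {a b : V}
    (hr : Reach E S a b) : Reach E T a b :=
  Relation.ReflTransGen.mono (fun _ _ h' => ⟨h'.1, h h'.2.1, h h'.2.2⟩) _ _ hr

theorem exists_cut_of_two_nbrs (hG : InternalCore G x) (hK : ¬ HasK4At G x) {p q r : V}
    (hpx : p ≠ x) (hqx : q ≠ x) (hrx : r ≠ x) (hqr : q ≠ r) (hpq : s(p, q) ∈ G.edges)
    (hpr : s(p, r) ∈ G.edges) : G.edges.count s(p, q) = 2 ∧ ∃ X ⊆ G.verts, x ∈ X ∧ q ∈ X ∧ r ∈ X ∧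
      p ∉ X ∧ ∀ e ∈ G.edges, Crosses X e → e = s(p, q) ∨ e = s(p, r) := by
  have c1 := hG.two_le_count hK hpx hqx hrx hqr hpq hpr
  have c2 := hG.two_le_count hK hpx hrx hqx hqr.symm hpr hpq
  have hne : s(p, q) ≠ s(p, r) := by rwa [Ne, Sym2.congr_right]
  have hpG := left_mem_of_mem_edges hpq
  have hqG := right_mem_of_mem_edges hpq
  have hrG := right_mem_of_mem_edges hpr
  have npq := ne_of_mem_edges hpq
  have npr := ne_of_mem_edges hpr
  set F : Multiset (Sym2 V) := Multiset.replicate 2 s(p, q) + Multiset.replicate 2 s(p, r) with hF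
  have hFle : F ≤ G.edges := by
    rw [Multiset.le_iff_count]
    intro e
    simp only [hF, Multiset.count_add, Multiset.count_replicate]
    by_cases h1 : s(p, q) = e
    · subst h1; simp [hne.symm, c1]
    · by_cases h2 : s(p, r) = e
      · subst h2; simp [hne, c2]
      · simp [h1, h2]
  by_cases hcut : ∀ X ⊆ G.verts, x ∈ X →
      Multiset.card {p, q, r} ≤ cutCount (G.edges - F) X + Multiset.countP (· ∈ X) {p, q, r}
  · exfalso
    have hr := (route_of_cut (fun e he => G.edge_support e (Multiset.mem_of_le tsub_le_self he))
      hG.root _ hcut).add (Route.refl (E := F))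
    rw [tsub_add_cancel_of_le hFle] at hr
    refine hK ⟨p, hpG, q, hqG, r, hrG, hpx.symm, hqx.symm, hrx.symm, npq, npr, hqr, hr.trans ?_⟩
    have := (Route.pair q p r).add_right {s(x, p), s(x, q), s(x, r), s(p, q), s(p, r)}
    rw [Sym2.eq_swap (a := q) (b := p)] at this
    refine (Route.of_le (le_of_eq ?_)).trans (this.mono (le_of_eq ?_)) <;>
    · simp [hF, Multiset.replicate_succ, ← Multiset.singleton_add]
      try abel
  · push Not at hcut
    obtain ⟨X, hX, hxX, hlt⟩ := hcut
    have hsplit : cutCount G.edges X = cutCount (G.edges - F) X + cutCount F X :=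
      countP_eq_sub_add hFle (Crosses X)
    have hFcut : cutCount F X = (if Crosses X s(p, q) then 2 else 0) +
        if Crosses X s(p, r) then 2 else 0 := by
      rw [cutCount, hF, Multiset.countP_add, Multiset.replicate_succ, Multiset.replicate_one,
        Multiset.replicate_succ, Multiset.replicate_one]
      simp only [Multiset.countP_cons, ← Multiset.cons_zero, Multiset.countP_zero]
      split_ifs <;> rfl
    simp only [crosses_mk] at hFcut
    have hlt' : cutCount (G.edges - F) X + (((if r ∈ X then 1 else 0) + if q ∈ X then 1 else 0) +
        if p ∈ X then 1 else 0) < 3 := by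
      simpa [Multiset.countP_cons, ← Multiset.cons_zero] using hlt
    have three : ∀ w ∈ G.verts, w ∉ X → 3 ≤ cutCount G.edges X := hG.three X hX x hxX
    have t1 := three p hpG
    have t2 := three q hqG
    have t3 := three r hrG
    have four : ∀ a b c : V, a ∈ X → a ≠ x → b ∈ G.verts → b ∉ X → c ∈ G.verts → c ∉ X → b ≠ c →
        4 ≤ cutCount G.edges X := by
      intro a b c ha hax hb hbX hc hcX hbc
      refine hG.four X hX ?_ ?_
      · rw [← Finset.card_pair hax]
        exact Finset.card_le_card (by simp [Finset.insert_subset_iff, *])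
      · rw [← Finset.card_pair hbc]
        exact Finset.card_le_card (by simp [Finset.insert_subset_iff, *])
    have f1 := fun h1 h2 h3 => four q p r h1 hqx hpG h2 hrG h3 npr
    have f2 := fun h1 h2 h3 => four r p q h1 hrx hpG h2 hqG h3 npq
    have hreach : p ∈ X → q ∉ X → r ∉ X → 6 ≤ cutCount G.edges X := by
      intro h1 h2 h3
      by_contra! hlt
      refine hK (hG.hasK4At_of_reach hpx hqx hqr hpq hpr ?_)
      refine reach_mono (S := G.verts \ X) ?_ (hG.reach_of_cutCount_le Finset.sdiff_subset hG.root
        (by simp [hxX]) ?_ (by simp [h2, hqG]) (by simp [h3, hrG]))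
      · refine Finset.sdiff_subset_sdiff le_rfl ?_
        simp [Finset.insert_subset_iff, hxX, h1]
      · rw [cutCount_compl G.edge_support]
        omega
    have hmain : q ∈ X ∧ r ∈ X ∧ p ∉ X ∧ cutCount (G.edges - F) X = 0 := by
      by_cases hp : p ∈ X <;> by_cases hq : q ∈ X <;> by_cases hr : r ∈ X <;>
        simp [hp, hq, hr] at * <;> omega
    obtain ⟨hq, hr, hp, h0⟩ := hmain
    have hcr : ∀ e ∈ G.edges, Crosses X e → G.edges.count e ≤ F.count e := by
      intro e he hc
      have := Multiset.countP_eq_zero.1 h0 e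
      rw [Multiset.mem_sub] at this
      by_contra h
      exact this (by omega) hc
    refine ⟨?_, X, hX, hxX, hq, hr, hp, ?_⟩
    · have := hcr _ hpq (by simp [crosses_mk, hp, hq])
      simp only [hF, Multiset.count_add, Multiset.count_replicate, hne.symm, if_true,
        if_false] at this
      omega
    · intro e he hc
      have h1 := hcr e he hc
      have h2 := Multiset.count_pos.2 he
      simp only [hF, Multiset.count_add, Multiset.count_replicate] at h1
      by_contra hcon
      rw [not_or] at hcon
      rw [if_neg fun h => hcon.1 h.symm, if_neg fun h => hcon.2 h.symm] at h1
      omega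

/-- A vertex with two distinct non-root neighbours has exactly these two neighbours. -/
theorem eq_or_eq_of_two_nbrs (hG : InternalCore G x) (hK : ¬ HasK4At G x) {p q r w : V}
    (hpx : p ≠ x) (hqx : q ≠ x) (hrx : r ≠ x) (hqr : q ≠ r) (hpq : s(p, q) ∈ G.edges)
    (hpr : s(p, r) ∈ G.edges) (hpw : s(p, w) ∈ G.edges) : w = q ∨ w = r := by
  obtain ⟨hc, X, hX, hxX, hqX, hrX, hpX, hcr⟩ :=
    hG.exists_cut_of_two_nbrs hK hpx hqx hrx hqr hpq hpr
  by_contra hw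
  rw [not_or] at hw
  by_cases hwx : w = x
  · subst hwx
    rcases hcr _ hpw (by simp [crosses_mk, hxX, hpX]) with h | h
    · exact hw.1 (Sym2.congr_right.1 h)
    · exact hw.2 (Sym2.congr_right.1 h)
  · obtain ⟨-, Y, hY, hxY, hqY, hwY, hpY, hcr'⟩ :=
      hG.exists_cut_of_two_nbrs hK hpx hqx hwx (fun h => hw.1 h.symm) hpq hpw
    have h3 := hG.three (X ∩ Y) (Finset.inter_subset_left.trans hX) x (by simp [hxX, hxY]) p
      (left_mem_of_mem_edges hpq) (by simp [hpX])
    have h4 : cutCount G.edges (X ∩ Y) ≤ G.edges.count s(p, q) := by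
      rw [cutCount, Multiset.count]
      refine countP_mono_of_imp fun e he => ?_
      rintro ⟨u, v, rfl, hu, hv⟩
      rw [Finset.mem_inter] at hu hv
      have hup : u ≠ p := by rintro rfl; exact hpX hu.1
      have k1 : v ∉ X → s(u, v) = s(p, q) ∨ s(u, v) = s(p, r) := fun h =>
        hcr _ he (crosses_mk.2 (Or.inl ⟨hu.1, h⟩))
      have k2 : v ∉ Y → s(u, v) = s(p, q) ∨ s(u, v) = s(p, w) := fun h =>
        hcr' _ he (crosses_mk.2 (Or.inl ⟨hu.2, h⟩))
      simp only [Sym2.eq_iff, hup, false_and, false_or] at k1 k2 ⊢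
      grind
    omega

theorem isChain_mem_edges_reverse {E : Multiset (Sym2 V)} {l : List V}
    (h : l.IsChain fun u v => s(u, v) ∈ E) : l.reverse.IsChain fun u v => s(u, v) ∈ E :=
  List.isChain_reverse.2 (h.imp fun _ _ => mem_edges_swap)

theorem reach_of_isChain {E : Multiset (Sym2 V)} {S : Finset V} {l : List V} {b r : V}
    (h : (b :: l).IsChain fun u v => s(u, v) ∈ E) (hS : ∀ v ∈ b :: l, v ∈ S) (hr : r ∈ b :: l) :
    Reach E S b r := by
  induction l generalizing b with
  | nil =>
    obtain rfl : r = b := by simpa using hr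
    exact .refl
  | cons c l ih =>
    rw [List.isChain_cons_cons] at h
    rcases List.mem_cons.1 hr with rfl | hr
    · exact .refl
    · exact .head ⟨h.1, hS _ (by simp), hS _ (by simp)⟩
        (ih h.2 (fun v hv => hS v (List.mem_cons_of_mem _ hv)) hr)

theorem eq_or_eq_of_isChain (hG : InternalCore G x) (hK : ¬ HasK4At G x) {s t : List V}
    {q p r w : V} (hn : (s ++ q :: p :: r :: t).Nodup)
    (hc : (s ++ q :: p :: r :: t).IsChain fun u v => s(u, v) ∈ G.edges)
    (hx : x ∉ s ++ q :: p :: r :: t) (hw : s(p, w) ∈ G.edges) :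
    G.edges.count s(p, q) = 2 ∧ G.edges.count s(p, r) = 2 ∧ (w = q ∨ w = r) := by
  rw [List.isChain_append_cons_cons, List.isChain_cons_cons] at hc
  have hqr : q ≠ r := by
    rintro rfl
    simp [List.nodup_append] at hn
  simp only [List.mem_append, List.mem_cons, not_or] at hx
  have h1 := mem_edges_swap hc.2.1
  have h2 := hc.2.2.1
  have n1 : q ≠ x := fun h => hx.2.1 h.symm
  have n2 : p ≠ x := fun h => hx.2.2.1 h.symm
  have n3 : r ≠ x := fun h => hx.2.2.2.1 h.symm
  exact ⟨(hG.exists_cut_of_two_nbrs hK n2 n1 n3 hqr h1 h2).1,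
    (hG.exists_cut_of_two_nbrs hK n2 n3 n1 hqr.symm h2 h1).1,
    hG.eq_or_eq_of_two_nbrs hK n2 n1 n3 hqr h1 h2 hw⟩

/-- Paths of all possible lengths avoiding the root. -/
theorem exists_path_of_length (hG : InternalCore G x) (hK : ¬ HasK4At G x) (n : ℕ) (h1 : 1 ≤ n)
    (hn : n ≤ (G.verts.erase x).card) : ∃ l : List V, l.length = n ∧ l.Nodup ∧
      (l.IsChain fun u v => s(u, v) ∈ G.edges) ∧ ∀ v ∈ l, v ∈ G.verts.erase x := by
  induction n, h1 using Nat.le_induction with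
  | base =>
    obtain ⟨a, ha⟩ := Finset.card_pos.1 hn
    exact ⟨[a], by simp, by simp, by simp, by simpa using ha⟩
  | succ n hn1 ih =>
    obtain ⟨l, hl, hnd, hc, hS⟩ := ih (by omega)
    obtain ⟨w, hw, hwl⟩ : ∃ w ∈ G.verts.erase x, w ∉ l := by
      by_contra! h
      have := Finset.card_le_card (s := G.verts.erase x) (t := l.toFinset)
        fun v hv => List.mem_toFinset.2 (h v hv)
      have := List.toFinset_card_le l
      omega
    obtain ⟨a, ha⟩ := List.exists_mem_of_length_pos (l := l) (by omega)
    have ha' := Finset.mem_erase.1 (hS a ha)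
    have hw' := Finset.mem_erase.1 hw
    have hr := hG.reach_of_not_hasK4At hK ha'.2 ha'.1 hw'.2 hw'.1
    obtain ⟨u, v, hu, hv, huv, hvS⟩ : ∃ u v, u ∈ l ∧ v ∉ l ∧ s(u, v) ∈ G.edges ∧
        v ∈ G.verts.erase x := by
      clear hw hw'
      induction hr with
      | refl => exact absurd ha hwl
      | @tail b c hab hbc ih =>
        by_cases hb : b ∈ l
        · exact ⟨b, c, hb, hwl, hbc.1, hbc.2.2⟩
        · exact ih hb
    obtain ⟨s, t, rfl⟩ := List.append_of_mem hu
    rcases t with _ | ⟨r, t⟩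
    · refine ⟨(s ++ [u]) ++ [v], by simpa using hl, ?_, ?_, ?_⟩
      · rw [List.nodup_append_comm]
        simpa using ⟨by simpa using hv, by simpa using hnd⟩
      · rw [List.append_assoc]
        exact List.isChain_append_cons_cons.2 ⟨hc, huv, by simp⟩
      · intro z hz
        rcases List.mem_append.1 hz with hz | hz
        · exact hS z hz
        · rwa [List.mem_singleton.1 hz]
    · rcases List.eq_nil_or_concat s with rfl | ⟨s, q, rfl⟩
      · refine ⟨v :: u :: r :: t, by simpa using hl, List.nodup_cons.2 ⟨hv, hnd⟩,
          List.isChain_cons_cons.2 ⟨mem_edges_swap huv, hc⟩, ?_⟩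
        intro z hz
        rcases List.mem_cons.1 hz with rfl | hz
        · exact hvS
        · exact hS z hz
      · rw [List.concat_eq_append, List.append_assoc] at *
        have := (hG.eq_or_eq_of_isChain hK hnd hc
          (fun h => (Finset.mem_erase.1 (hS x h)).1 rfl) huv).2.2
        exact absurd (by rcases this with rfl | rfl <;> simp) hv

/-- A path through all vertices except the root. -/
structure SpanPath (G : MG V) (x : V) (l : List V) : Prop where
  nodup : l.Nodup
  isChain : l.IsChain fun u v => s(u, v) ∈ G.edges
  mem_iff : ∀ v, v ∈ l ↔ v ∈ G.verts ∧ v ≠ x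
  length : 3 ≤ l.length

theorem exists_spanPath (hG : InternalCore G x) (hK : ¬ HasK4At G x) :
    ∃ l, SpanPath G x l := by
  have hc := Finset.card_erase_of_mem hG.root
  have := hG.card
  obtain ⟨l, hl, hnd, hch, hS⟩ := hG.exists_path_of_length hK _ (by omega) le_rfl
  refine ⟨l, hnd, hch, fun v => ?_, by omega⟩
  have : l.toFinset = G.verts.erase x :=
    Finset.eq_of_subset_of_card_le (fun v hv => hS v (List.mem_toFinset.1 hv))
      (by rw [List.toFinset_card_of_nodup hnd, hl])
  rw [← List.mem_toFinset, this, Finset.mem_erase, and_comm]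

theorem SpanPath.reverse {l : List V} (h : SpanPath G x l) : SpanPath G x l.reverse where
  nodup := List.nodup_reverse.2 h.nodup
  isChain := isChain_mem_edges_reverse h.isChain
  mem_iff v := by rw [List.mem_reverse, h.mem_iff]
  length := by simpa using h.length

theorem SpanPath.notMem {l : List V} (h : SpanPath G x l) : x ∉ l := fun hx =>
  ((h.mem_iff x).1 hx).2 rfl

theorem SpanPath.eq_or_eq_head {l : List V} {a b r : V} (h : SpanPath G x (a :: b :: l))
    (hG : InternalCore G x) (hK : ¬ HasK4At G x) (hr : s(a, r) ∈ G.edges) : r = x ∨ r = b := by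
  by_contra! hcon
  have hc := List.isChain_cons_cons.1 h.isChain
  have hm := fun v (hv : v ∈ b :: l) => (h.mem_iff v).1 (List.mem_cons_of_mem _ hv)
  have hnd := (List.nodup_cons.1 h.nodup).1
  have hra : r ≠ a := (ne_of_mem_edges hr).symm
  have hrl : r ∈ b :: l := by
    have := (h.mem_iff r).2 ⟨right_mem_of_mem_edges hr, hcon.1⟩
    exact (List.mem_cons.1 this).resolve_left hra
  refine hK (hG.hasK4At_of_reach (c := a) (p := b) (q := r) ((h.mem_iff a).1 (by simp)).2
    (hm b (by simp)).2 hcon.2.symm hc.1 hr (reach_of_isChain hc.2 ?_ hrl))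
  intro v hv
  have hva : v ≠ a := by rintro rfl; exact hnd hv
  simp [hm v hv, hva]

theorem SpanPath.count_head {l : List V} {a b : V} (h : SpanPath G x (a :: b :: l))
    (hG : InternalCore G x) (hK : ¬ HasK4At G x) : G.edges.count s(a, b) = 2 := by
  have hl := h.length
  rcases l with _ | ⟨c, t⟩
  · simp at hl
  · have hc := List.isChain_cons_cons.1 h.isChain
    have := (hG.eq_or_eq_of_isChain hK (s := []) h.nodup h.isChain h.notMem
      (mem_edges_swap hc.1)).1
    rwa [Sym2.eq_swap]

/-- Edges within the path are path edges of multiplicity two. -/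
theorem SpanPath.mem_walkEdges {l : List V} {u v : V} (h : SpanPath G x l)
    (hG : InternalCore G x) (hK : ¬ HasK4At G x) (hux : u ≠ x) (hvx : v ≠ x)
    (he : s(u, v) ∈ G.edges) : s(u, v) ∈ walkEdges l ∧ G.edges.count s(u, v) = 2 := by
  have hu := (h.mem_iff u).2 ⟨left_mem_of_mem_edges he, hux⟩
  have head : ∀ {l : List V}, SpanPath G x l → l.head? = some u →
      s(u, v) ∈ walkEdges l ∧ G.edges.count s(u, v) = 2 := by
    intro l h hh
    have hl := h.length
    match l, hl with
    | a :: b :: l, _ =>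
      obtain rfl : a = u := by simpa using hh
      obtain rfl := (h.eq_or_eq_head hG hK he).resolve_left hvx
      exact ⟨by simp [walkEdges_cons_cons], h.count_head hG hK⟩
  obtain ⟨s, t, rfl⟩ := List.append_of_mem hu
  rcases t with _ | ⟨r, t⟩
  · have := head h.reverse (by simp)
    rwa [walkEdges_reverse] at this
  · rcases List.eq_nil_or_concat s with rfl | ⟨s, q, rfl⟩
    · exact head h rfl
    · rw [List.concat_eq_append, List.append_assoc, List.cons_append, List.nil_append] at *
      obtain ⟨h1, h2, rfl | rfl⟩ := hG.eq_or_eq_of_isChain hK h.nodup h.isChain h.notMem he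
      · refine ⟨?_, h1⟩
        rw [walkEdges_append, walkEdges_cons_cons, Sym2.eq_swap]
        simp
      · refine ⟨?_, h2⟩
        rw [walkEdges_append, walkEdges_cons_cons, walkEdges_cons_cons]
        simp

/-- The root is joined only to the ends of the path. -/
theorem SpanPath.head_or_getLast {l : List V} {r : V} (h : SpanPath G x l)
    (hG : InternalCore G x) (hK : ¬ HasK4At G x) (he : s(x, r) ∈ G.edges) :
    l.head? = some r ∨ l.getLast? = some r := by
  have hr := (h.mem_iff r).2 ⟨right_mem_of_mem_edges he, (ne_of_mem_edges he).symm⟩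
  obtain ⟨s, t, rfl⟩ := List.append_of_mem hr
  rcases t with _ | ⟨q, t⟩
  · simp
  · rcases List.eq_nil_or_concat s with rfl | ⟨s, p, rfl⟩
    · simp
    · rw [List.concat_eq_append, List.append_assoc, List.cons_append, List.nil_append] at *
      have := (hG.eq_or_eq_of_isChain hK h.nodup h.isChain h.notMem (mem_edges_swap he)).2.2
      exact absurd (by rcases this with rfl | rfl <;> simp) h.notMem

theorem SpanPath.two_le_count_getLast {l : List V} {a : V} (h : SpanPath G x l)
    (hG : InternalCore G x) (hK : ¬ HasK4At G x) (ha : l.getLast? = some a) :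
    2 ≤ G.edges.count s(x, a) := by
  have hl := h.length
  match l, hl with
  | m :: m' :: l, _ =>
    have hm := (h.mem_iff m).1 (by simp)
    have h4 := hG.four {x, m} (by simp [Finset.insert_subset_iff, hG.root, hm.1])
      (by rw [Finset.card_pair hm.2.symm]) (by
        rw [Finset.card_sdiff_of_subset (by simp [Finset.insert_subset_iff, hG.root, hm.1]),
          Finset.card_pair hm.2.symm]
        have := hG.card
        omega)
    have hle : cutCount G.edges {x, m} ≤ G.edges.count s(x, a) + G.edges.count s(m, m') := by
      rw [cutCount, Multiset.count, Multiset.count]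
      refine countP_le_add fun e he hc => ?_
      obtain ⟨u, v, rfl, hu, hv⟩ := hc
      simp only [Finset.mem_insert, Finset.mem_singleton, not_or] at hu hv
      rcases hu with rfl | rfl
      · rcases h.head_or_getLast hG hK he with h' | h'
        · exact absurd (by simpa using h'.symm) hv.2
        · rw [ha] at h'
          rw [Option.some.inj h']
          exact Or.inl rfl
      · rw [(h.eq_or_eq_head hG hK he).resolve_left hv.1]
        exact Or.inr rfl
    have := h.count_head hG hK
    omega

theorem closedEdges_of_getLast {c a m : V} {t : List V} (hm : (a :: t).getLast? = some m) :
    closedEdges c (a :: t) = s(c, a) ::ₘ s(c, m) ::ₘ walkEdges (a :: t) := by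
  obtain ⟨s, hs⟩ := List.getLast?_eq_some_iff.1 hm
  rw [closedEdges, List.cons_append, walkEdges_cons_cons, ← List.cons_append, hs, List.append_assoc,
    List.singleton_append, walkEdges_append, walkEdges_cons_cons, walkEdges_singleton,
    Sym2.eq_swap (a := m)]
  congr 1
  rw [← Multiset.singleton_add, ← Multiset.singleton_add, add_comm]
  rfl

theorem cycleEdges_get (l : List V) (c : V) :
    cycleEdges (c :: l).length (c :: l).get = closedEdges c l := by
  rw [cycleEdges, Fin.univ_val_map, closedEdges, walkEdges]
  congr 1
  apply List.ext_getElem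
  · simp
  · intro i h1 h2
    simp only [List.length_ofFn, List.length_cons] at h1
    simp only [List.getElem_ofFn, List.get_eq_getElem, List.getElem_map, List.getElem_zip,
      List.tail_cons]
    refine congrArg₂ (fun a b => s(a, b)) ?_ ?_
    · simp only [← List.cons_append]
      rw [List.getElem_append_left]
    · rcases Nat.lt_or_ge (i + 1) (l.length + 1) with h | h
      · simp only [List.length_cons, Nat.mod_eq_of_lt h, List.getElem_cons_succ]
        rw [List.getElem_append_left]
      · obtain rfl : i = l.length := by omega
        simp

theorem SpanPath.two_le_count {l : List V} {e : Sym2 V} (h : SpanPath G x l)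
    (hG : InternalCore G x) (hK : ¬ HasK4At G x) (he : e ∈ closedEdges x l) :
    2 ≤ G.edges.count e := by
  have hl := h.length
  match l, hl with
  | a :: t, _ =>
    obtain ⟨m, hm⟩ : ∃ m, (a :: t).getLast? = some m := ⟨_, List.getLast?_eq_some_getLast (by simp)⟩
    rw [closedEdges_of_getLast hm, Multiset.mem_cons, Multiset.mem_cons] at he
    rcases he with rfl | rfl | he
    · exact h.reverse.two_le_count_getLast hG hK (by simp)
    · exact h.two_le_count_getLast hG hK hm
    · have h1 := mem_edges_of_isChain h.isChain e he
      induction e with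
      | _ u v =>
        have hu := mem_of_mem_walkEdges he (v := u) (by simp)
        have hv := mem_of_mem_walkEdges he (v := v) (by simp)
        exact (h.mem_walkEdges hG hK ((h.mem_iff u).1 hu).2 ((h.mem_iff v).1 hv).2 h1).2.ge

theorem SpanPath.closedEdges_nodup {l : List V} (h : SpanPath G x l) :
    (closedEdges x l).Nodup :=
  nodup_closedEdges (by have := h.length; omega) (List.nodup_cons.2 ⟨h.notMem, h.nodup⟩)

theorem SpanPath.count_head_le {l : List V} {a : V} (h : SpanPath G x l) (hG : InternalCore G x)
    (hK : ¬ HasK4At G x) (ha : l.head? = some a) : G.edges.count s(x, a) ≤ 2 := by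
  by_contra! h3
  have hl := h.length
  match l, hl with
  | a' :: b :: t, hl =>
    obtain rfl : a' = a := by simpa using ha
    obtain ⟨m, hm⟩ : ∃ m, (b :: t).getLast? = some m := ⟨_, List.getLast?_eq_some_getLast (by simp)⟩
    have hmt : m ∈ b :: t := List.mem_of_getLast? hm
    have ham : a' ≠ m := by
      rintro rfl
      exact (List.nodup_cons.1 h.nodup).1 hmt
    have hbm : b ≠ m := by
      rintro rfl
      have hnd := (List.nodup_cons.1 h.nodup).2
      match t, hl with
      | c :: t, _ =>
        exact (List.nodup_cons.1 hnd).1 (List.mem_of_getLast? (by simpa using hm))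
    have hab : a' ≠ b := by
      rintro rfl
      exact (List.nodup_cons.1 h.nodup).1 (by simp)
    have hv := fun v (hv : v ∈ a' :: b :: t) => (h.mem_iff v).1 hv
    have hva := hv a' (by simp)
    have hvb := hv b (by simp)
    have hvm := hv m (List.mem_cons_of_mem _ hmt)
    have hcl : closedEdges x (a' :: b :: t) =
        s(x, a') ::ₘ s(x, m) ::ₘ s(a', b) ::ₘ walkEdges (b :: t) := by
      rw [closedEdges_of_getLast (m := m) (by simpa using hm), walkEdges_cons_cons]
    have hle : s(x, a') ::ₘ (2 • closedEdges x (a' :: b :: t)) ≤ G.edges := by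
      rw [Multiset.le_iff_count]
      intro e
      rw [Multiset.count_cons, Multiset.count_nsmul]
      have h1 := Multiset.nodup_iff_count_le_one.1 h.closedEdges_nodup e
      split_ifs with he
      · subst he
        omega
      · by_cases hmem : e ∈ closedEdges x (a' :: b :: t)
        · have := h.two_le_count hG hK hmem
          omega
        · rw [Multiset.count_eq_zero_of_notMem hmem]
          omega
    refine hK ⟨a', hva.1, b, hvb.1, m, hvm.1, hva.2.symm, hvb.2.symm, hvm.2.symm, hab, ham, hbm,
      Route.of_le_left hle ?_⟩
    rw [hcl]
    have hw : Route (walkEdges (b :: t)) {s(b, m)} := Route.walk _ _ _ ⟨rfl, hm⟩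
    have := (((Route.pair x a' b).add (Route.pair a' x m)).add hw).add_right
      {s(x, a'), s(x, m), s(a', b)}
    rw [Sym2.eq_swap (a := a') (b := x)] at this
    refine Route.of_le_left ((Multiset.le_add_right _ (walkEdges (b :: t))).trans_eq ?_)
      (this.mono (le_of_eq ?_)) <;>
    · simp only [two_nsmul, Multiset.insert_eq_cons, ← Multiset.singleton_add]
      abel

theorem hasK4At_or_isDoubledCycle (hG : InternalCore G x) : HasK4At G x ∨ IsDoubledCycle G := by
  by_contra! hcon
  obtain ⟨hK, hD⟩ := hcon
  obtain ⟨l, h⟩ := hG.exists_spanPath hK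
  refine hD ⟨(x :: l).length, by have := h.length; simp; omega, (x :: l).get,
    List.nodup_iff_injective_get.1 (List.nodup_cons.2 ⟨h.notMem, h.nodup⟩), ?_, ?_⟩
  · ext v
    rw [Finset.mem_image]
    have : (∃ a ∈ Finset.univ, (x :: l).get a = v) ↔ v ∈ x :: l := by
      simp [List.mem_iff_get]
    rw [this, List.mem_cons, h.mem_iff]
    constructor
    · rintro (rfl | h)
      exacts [hG.root, h.1]
    · intro hv
      by_cases hvx : v = x <;> simp [hv, hvx]
  · rw [cycleEdges_get]
    have hx : ∀ v, s(x, v) ∈ G.edges →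
        s(x, v) ∈ closedEdges x l ∧ G.edges.count s(x, v) ≤ 2 := by
      intro v hv
      have hor := h.head_or_getLast hG hK hv
      refine ⟨?_, ?_⟩
      · have hl := h.length
        match l, hl with
        | a :: t, _ =>
          obtain ⟨m, hm⟩ : ∃ m, (a :: t).getLast? = some m :=
            ⟨_, List.getLast?_eq_some_getLast (by simp)⟩
          rw [closedEdges_of_getLast hm]
          rcases hor with hh | hh
          · obtain rfl : a = v := by simpa using hh
            simp
          · rw [hm] at hh
            rw [Option.some.inj hh]
            simp
      · rcases hor with hh | hh
        · exact h.count_head_le hG hK hh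
        · exact h.reverse.count_head_le hG hK (by simpa using hh)
    have hall : ∀ e ∈ G.edges, e ∈ closedEdges x l ∧ G.edges.count e ≤ 2 := by
      intro e he
      induction e with
      | _ u v =>
        by_cases hu : u = x
        · subst hu
          exact hx v he
        · by_cases hv : v = x
          · subst hv
            rw [Sym2.eq_swap] at he ⊢
            exact hx u he
          · have := h.mem_walkEdges hG hK hu hv he
            refine ⟨?_, this.2.le⟩
            have hl := h.length
            match l, hl with
            | a :: t, _ =>
              obtain ⟨m, hm⟩ : ∃ m, (a :: t).getLast? = some m :=
                ⟨_, List.getLast?_eq_some_getLast (by simp)⟩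
              rw [closedEdges_of_getLast hm]
              simp [this.1]
    ext e
    rw [Multiset.count_nsmul]
    have h1 := Multiset.nodup_iff_count_le_one.1 h.closedEdges_nodup e
    by_cases hmem : e ∈ closedEdges x l
    · have h2 := h.two_le_count hG hK hmem
      have h3 := (hall e (Multiset.count_pos.1 (by omega))).2
      have h4 := Multiset.count_pos.2 hmem
      omega
    · rw [Multiset.count_eq_zero_of_notMem hmem,
        Multiset.count_eq_zero_of_notMem fun he => hmem (hall e he).1]

end InternalCore

/-- `SegTo G A B`: one can get from `A` to `B` by adding vertices one at a time, all edge-cuts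
having size three. -/
inductive SegTo (G : MG V) : Finset V → Finset V → Prop
  | refl (A : Finset V) : A ⊆ G.verts → cutCount G.edges A = 3 → SegTo G A A
  | step {A B : Finset V} (v : V) : SegTo G A B → v ∈ G.verts → v ∉ B →
      cutCount G.edges (insert v B) = 3 → SegTo G A (insert v B)

namespace SegTo

variable {G : MG V} {A B C : Finset V}

theorem right (h : SegTo G A B) : B ⊆ G.verts ∧ cutCount G.edges B = 3 := by
  induction h with
  | refl hA h3 => exact ⟨hA, h3⟩
  | step v _ hv _ h3 ih => exact ⟨Finset.insert_subset hv ih.1, h3⟩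

theorem left (h : SegTo G A B) : A ⊆ G.verts ∧ cutCount G.edges A = 3 := by
  induction h with
  | refl hA h3 => exact ⟨hA, h3⟩
  | step v _ _ _ _ ih => exact ih

theorem subset (h : SegTo G A B) : A ⊆ B := by
  induction h with
  | refl => exact le_rfl
  | step v _ _ _ _ ih => exact ih.trans (Finset.subset_insert _ _)

theorem trans (h : SegTo G A B) (h' : SegTo G B C) : SegTo G A C := by
  induction h' with
  | refl => exact h
  | step v _ hv hvB h3 ih => exact ih.step v hv hvB h3

theorem compl (h : SegTo G A B) : SegTo G (G.verts \ B) (G.verts \ A) := by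
  induction h with
  | refl hA h3 =>
    exact .refl _ Finset.sdiff_subset (by rwa [cutCount_compl G.edge_support])
  | @step B v hAB hv hvB h3 ih =>
    have heq : G.verts \ B = insert v (G.verts \ insert v B) := by
      ext w
      simp only [Finset.mem_sdiff, Finset.mem_insert]
      grind
    have hcut := hAB.right.2
    rw [heq] at ih
    refine SegTo.trans (.step v (.refl _ Finset.sdiff_subset ?_) hv (by simp) ?_) ih
    · rwa [cutCount_compl G.edge_support]
    · rwa [← heq, cutCount_compl G.edge_support]

theorem hasSegmentation (h : SegTo G A B) : HasSegmentation G A (G.verts \ B) 3 := by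
  suffices h : ∃ (n : ℕ) (C : Fin (n + 1) → Finset V),
      SegChain G n C 3 ∧ C 0 = A ∧ C (Fin.last n) = B by
    obtain ⟨n, C, h1, h2, h3⟩ := h
    exact ⟨n, C, h1, h2, by rw [h3]⟩
  induction h with
  | refl hA h3 =>
    exact ⟨0, fun _ => A, ⟨fun _ => hA, fun i => i.elim0, fun _ => by rwa [dcut_eq_cutCount]⟩,
      rfl, rfl⟩
  | @step B v _ hv hvB h3 ih =>
    obtain ⟨n, C, ⟨h1, h2, hd⟩, h0, hl⟩ := ih
    refine ⟨n + 1, Fin.snoc (α := fun _ => Finset V) C (insert v B), ⟨?_, ?_, ?_⟩, ?_, ?_⟩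
    · refine Fin.lastCases ?_ fun i => ?_
      · rw [Fin.snoc_last, ← hl]
        exact Finset.insert_subset hv (h1 _)
      · rw [Fin.snoc_castSucc]
        exact h1 i
    · refine Fin.lastCases ?_ fun i => ?_
      · rw [Fin.succ_last, Fin.snoc_last, Fin.snoc_castSucc, hl]
        refine ⟨Finset.subset_insert _ _, ?_⟩
        rw [Finset.insert_sdiff_of_notMem _ hvB, Finset.sdiff_self]
        simp
      · rw [Fin.snoc_castSucc, Fin.succ_castSucc, Fin.snoc_castSucc]
        exact h2 i
    · refine Fin.lastCases ?_ fun i => ?_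
      · rwa [Fin.snoc_last, dcut_eq_cutCount]
      · rw [Fin.snoc_castSucc]
        exact hd i
    · rw [← Fin.castSucc_zero, Fin.snoc_castSucc, h0]
    · rw [Fin.snoc_last]

/-- A segmentation of width three cannot add a vertex of degree three. -/
theorem mem_of_cutCount_singleton (h : SegTo G A B) {y : V} (hy : cutCount G.edges {y} = 3)
    (hB : y ∈ B) : y ∈ A := by
  induction h with
  | refl => exact hB
  | @step B v hAB hv hvB h3 ih =>
    rcases Finset.mem_insert.1 hB with rfl | hB
    · have h1 := cutCount_add_two_mul_countP G.loopless (insert y B)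
      have h2 := cutCount_add_two_mul_countP G.loopless B
      have h4 := cutCount_add_two_mul_countP G.loopless {y}
      rw [Finset.sum_insert hvB] at h1
      rw [Finset.sum_singleton] at h4
      have := hAB.right.2
      omega
    · exact ih hB

end SegTo

theorem cutCount_even_of_isDoubledCycle {G : MG V} (h : IsDoubledCycle G) (X : Finset V) :
    Even (cutCount G.edges X) := by
  obtain ⟨n, -, f, -, -, hE⟩ := h
  rw [cutCount, hE, Multiset.countP_nsmul]
  exact even_two_mul _

/-- The graph obtained by identifying `Y` to the vertex `y₀`. -/
abbrev contract (G : MG V) (Y : Finset V) (y₀ : V) : MG V := mapGraph (collapseFun Y y₀) G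

section contract

variable {G : MG V} {Y : Finset V} {y₀ : V}

theorem mem_contract_verts (hY : Y ⊆ G.verts) (hy : y₀ ∈ Y) {v : V} :
    v ∈ (contract G Y y₀).verts ↔ (v ∈ G.verts ∧ v ∉ Y) ∨ v = y₀ := by
  simp only [contract, mapGraph, collapseFun, Finset.mem_image]
  grind

theorem cutCount_contract (Z : Finset V) : cutCount (contract G Y y₀).edges Z =
    cutCount G.edges (G.verts.filter fun v => collapseFun Y y₀ v ∈ Z) := by
  rw [cutCount, cutCount, contract, mapGraph, Multiset.countP_filter, Multiset.countP_map,
    ← Multiset.countP_eq_card_filter]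
  refine Multiset.countP_congr rfl fun e he => ?_
  induction e with
  | _ a b =>
    have ha := G.edge_support _ he a (by simp)
    have hb := G.edge_support _ he b (by simp)
    simp only [Sym2.map_mk, crosses_mk, Sym2.mk_isDiag_iff, Finset.mem_filter, ha, hb]
    grind

theorem cutCount_contract_of_mem {Z : Finset V} (hY : Y ⊆ G.verts) (hy : y₀ ∈ Y)
    (hZ : Z ⊆ (contract G Y y₀).verts) (hyZ : y₀ ∈ Z) :
    cutCount (contract G Y y₀).edges Z = cutCount G.edges (Z ∪ Y) := by
  rw [cutCount_contract]
  congr 1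
  ext v
  have := fun h : v ∈ Z => (mem_contract_verts hY hy).1 (hZ h)
  have := @hY v
  simp only [collapseFun, Finset.mem_union]
  grind

theorem exists_split_edges (Y : Finset V) (E : Multiset (Sym2 V)) :
    ∃ (E₁ E₂ : Multiset (Sym2 V)) (D : Multiset (V × V)),
      E = E₁ + E₂ + D.map (fun p => s(p.1, p.2)) ∧ (∀ e ∈ E₁, ∀ v ∈ e, v ∉ Y) ∧
      (∀ e ∈ E₂, ∀ v ∈ e, v ∈ Y) ∧ ∀ p ∈ D, p.1 ∉ Y ∧ p.2 ∈ Y := by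
  induction E using Multiset.induction_on with
  | empty => exact ⟨0, 0, 0, by simp⟩
  | cons e E ih =>
    obtain ⟨E₁, E₂, D, rfl, h1, h2, h3⟩ := ih
    induction e with
    | _ a b =>
      by_cases ha : a ∈ Y <;> by_cases hb : b ∈ Y
      · exact ⟨E₁, s(a, b) ::ₘ E₂, D, by simp, h1, by simpa [ha, hb] using h2, h3⟩
      · exact ⟨E₁, E₂, (b, a) ::ₘ D, by simp [Sym2.eq_swap], h1, h2, by simpa [ha, hb] using h3⟩
      · exact ⟨E₁, E₂, (a, b) ::ₘ D, by simp, h1, h2, by simpa [ha, hb] using h3⟩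
      · exact ⟨s(a, b) ::ₘ E₁, E₂, D, by simp, by simpa [ha, hb] using h1, h2, h3⟩

theorem route_join (D : Multiset (V × V)) (y : V) :
    Route (D.map (fun p => s(y, p.2)) + D.map fun p => s(p.1, p.2)) (D.map fun p => s(p.1, y)) := by
  induction D using Multiset.induction_on with
  | empty => exact Route.of_le (by simp)
  | cons p D ih =>
    simp only [Multiset.map_cons]
    have := (Route.pair p.1 p.2 y).add ih
    rw [Sym2.eq_swap (a := p.2)] at this
    refine (Route.of_le (le_of_eq ?_)).trans (this.mono (le_of_eq ?_))
    · simp only [Multiset.insert_eq_cons, ← Multiset.singleton_add]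
      abel
    · simp

/-- If `Y` is the far side of a cut of size three, `G` immerses the graph obtained by
identifying `Y` to a vertex. -/
theorem route_contract (h3 : ∀ X ⊆ G.verts, ∀ a ∈ X, ∀ b ∈ G.verts, b ∉ X →
    3 ≤ cutCount G.edges X) (hY : Y ⊆ G.verts) (hy : y₀ ∈ Y) {b : V} (hb : b ∈ G.verts)
    (hbY : b ∉ Y) (hcut : cutCount G.edges Y = 3) : Route G.edges (contract G Y y₀).edges := by
  obtain ⟨E₁, E₂, D, hE, h1, h2, hD⟩ := exists_split_edges Y G.edges
  have hc1 : ∀ Z ⊆ Y, cutCount E₁ Z = 0 := fun Z hZ => Multiset.countP_eq_zero.2 (by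
    rintro _ he ⟨u, v, rfl, hu, -⟩
    exact h1 _ he u (by simp) (hZ hu))
  have hcD : ∀ Z ⊆ Y, cutCount (D.map fun p => s(p.1, p.2)) Z =
      (D.map Prod.snd).countP (· ∈ Z) := by
    intro Z hZ
    rw [cutCount, Multiset.countP_map, Multiset.countP_map]
    congr 1
    refine Multiset.filter_congr fun p hp => ?_
    rw [crosses_mk]
    have : p.1 ∉ Z := fun h => (hD p hp).1 (hZ h)
    simp [this]
  have hsum : ∀ Z ⊆ Y, cutCount G.edges Z = cutCount E₂ Z + (D.map Prod.snd).countP (· ∈ Z) := by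
    intro Z hZ
    rw [← hcD Z hZ, hE, cutCount, Multiset.countP_add, Multiset.countP_add]
    change cutCount E₁ Z + cutCount E₂ Z + _ = _
    rw [hc1 Z hZ, zero_add]
    rfl
  have hcard : (D.map Prod.snd).card = 3 := by
    have h0 : cutCount E₂ Y = 0 := Multiset.countP_eq_zero.2 (by
      rintro _ he ⟨u, v, rfl, -, hv⟩
      exact hv (h2 _ he v (by simp)))
    rw [← hcut, hsum Y le_rfl, h0, zero_add, eq_comm, Multiset.countP_eq_card]
    intro v hv
    obtain ⟨p, hp, rfl⟩ := Multiset.mem_map.1 hv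
    exact (hD p hp).2
  have hr := InternalCore.route_of_cut (E := E₂) (U := Y) h2 hy (D.map Prod.snd) (by
    intro Z hZ hyZ
    rw [hcard, ← hsum Z hZ]
    exact h3 Z (hZ.trans hY) y₀ hyZ b hb fun h => hbY (hZ h))
  rw [Multiset.map_map] at hr
  have hr' := ((hr.add_right (D.map fun p : V × V => s(p.1, p.2))).trans
    (route_join D y₀)).add_right E₁
  refine (Route.of_le (le_of_eq ?_)).trans (hr'.mono ?_)
  · rw [hE]; abel
  · change Multiset.filter _ (Multiset.map _ G.edges) ≤ _
    rw [hE, Multiset.map_add, Multiset.map_add, Multiset.filter_add,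
      Multiset.filter_add, add_comm (Multiset.map _ D)]
    refine add_le_add ?_ ?_
    · rw [← add_zero E₁]
      refine add_le_add ((Multiset.filter_le _ _).trans (le_of_eq ?_)) (le_of_eq ?_)
      · rw [add_zero]
        conv_rhs => rw [← Multiset.map_id E₁]
        refine Multiset.map_congr rfl fun e he => ?_
        induction e with
        | _ a b =>
          have ha := h1 _ he a (by simp)
          have hb := h1 _ he b (by simp)
          simp [collapseFun, ha, hb]
      · rw [Multiset.filter_eq_nil]
        intro e' he'
        obtain ⟨e, he, rfl⟩ := Multiset.mem_map.1 he'
        clear he'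
        induction e with
        | _ a b =>
          have ha := h2 _ he a (by simp)
          have hb := h2 _ he b (by simp)
          simp [collapseFun, ha, hb]
    · refine (Multiset.filter_le _ _).trans (le_of_eq ?_)
      rw [Multiset.map_map]
      refine Multiset.map_congr rfl fun p hp => ?_
      simp [collapseFun, hD p hp]

end contract

section contract

variable {G : MG V} {Y : Finset V} {y₀ : V}

theorem SegTo.of_contract (hY : Y ⊆ G.verts) (hy : y₀ ∈ Y) {A B : Finset V}
    (h : SegTo (contract G Y y₀) A B) (hA : y₀ ∈ A) : SegTo G (A ∪ Y) (B ∪ Y) := by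
  have hsub : ∀ {Z}, Z ⊆ (contract G Y y₀).verts → Z ∪ Y ⊆ G.verts := by
    intro Z hZ v hv
    rcases Finset.mem_union.1 hv with hv | hv
    · rcases (mem_contract_verts hY hy).1 (hZ hv) with h | rfl
      exacts [h.1, hY hy]
    · exact hY hv
  induction h with
  | refl hV h3 =>
    exact .refl _ (hsub hV) (by rw [← cutCount_contract_of_mem hY hy hV hA, h3])
  | @step B v hAB hv hvB h3 ih =>
    have hyB : y₀ ∈ B := hAB.subset hA
    rw [Finset.insert_union]
    have hvy : v ≠ y₀ := by rintro rfl; exact hvB hyB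
    have hv' := ((mem_contract_verts hY hy).1 hv).resolve_right hvy
    refine ih.step v hv'.1 (by simp [hvB, hv'.2]) ?_
    rw [← Finset.insert_union, ← cutCount_contract_of_mem hY hy
      (Finset.insert_subset hv hAB.right.1) (Finset.mem_insert_of_mem hyB), h3]

end contract

/-- `3`-edge-connectivity, in terms of pairs of separated vertices. -/
def ThreeConn (G : MG V) : Prop :=
  ∀ X ⊆ G.verts, ∀ a ∈ X, ∀ b ∈ G.verts, b ∉ X → 3 ≤ cutCount G.edges X

/-- `G` has a `(2,2)`-segmentation of width three. -/
def HasSeg (G : MG V) : Prop :=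
  ∃ A B, A.card ≤ 2 ∧ (G.verts \ B).card ≤ 2 ∧ SegTo G A B

theorem ThreeConn.contract {G : MG V} {Y : Finset V} {y₀ : V} (h : ThreeConn G)
    (hY : Y ⊆ G.verts) (hy : y₀ ∈ Y) : ThreeConn (contract G Y y₀) := by
  intro X hX a ha b hb hbX
  rw [cutCount_contract]
  have ha' := (mem_contract_verts hY hy).1 (hX ha)
  have hb' := (mem_contract_verts hY hy).1 hb
  have hm : ∀ v, (v ∈ G.verts ∧ v ∉ Y) ∨ v = y₀ → v ∈ G.verts ∧ collapseFun Y y₀ v = v := by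
    rintro v (h | rfl)
    · exact ⟨h.1, if_neg h.2⟩
    · exact ⟨hY hy, by simp [collapseFun]⟩
  refine h _ (Finset.filter_subset _ _) a ?_ b (hm b hb').1 ?_
  · rw [Finset.mem_filter, (hm a ha').2]
    exact ⟨(hm a ha').1, ha⟩
  · rw [Finset.mem_filter, (hm b hb').2]
    exact fun h => hbX h.2

theorem exists_segTo_of_contract {G : MG V} {x : V} (h3 : ThreeConn G) (hx : x ∈ G.verts)
    (hK : ¬ HasK4At G x)
    (ih : ∀ G' : MG V, G'.verts.card < G.verts.card → ThreeConn G' → 4 ≤ G'.verts.card →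
      x ∈ G'.verts → HasK4At G' x ∨ IsDoubledCycle G' ∨ HasSeg G')
    {Y : Finset V} (hY : Y ⊆ G.verts) (hY2 : 2 ≤ Y.card)
    (hcut : cutCount G.edges Y = 3) : ∃ B, SegTo G Y B ∧ (G.verts \ B).card ≤ 2 := by
  by_cases hX3 : (G.verts \ Y).card ≤ 2
  · exact ⟨Y, .refl _ hY hcut, hX3⟩
  obtain ⟨y₀, hy, hyx⟩ : ∃ y₀ ∈ Y, x ∈ Y → y₀ = x := by
    by_cases hxY : x ∈ Y
    · exact ⟨x, hxY, fun _ => rfl⟩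
    · obtain ⟨y, hy⟩ := Finset.card_pos.1 (show 0 < Y.card by omega)
      exact ⟨y, hy, fun h => absurd h hxY⟩
  obtain ⟨b, hb⟩ := Finset.card_pos.1 (show 0 < (G.verts \ Y).card by omega)
  rw [Finset.mem_sdiff] at hb
  have hverts : (contract G Y y₀).verts = insert y₀ (G.verts \ Y) := by
    ext v
    rw [mem_contract_verts hY hy, Finset.mem_insert, Finset.mem_sdiff, or_comm]
  have hc : (contract G Y y₀).verts.card = (G.verts \ Y).card + 1 := by
    rw [hverts, Finset.card_insert_of_notMem (by simp [hy])]
  have hsum := Finset.card_sdiff_add_card_eq_card hY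
  have hsingle : cutCount (contract G Y y₀).edges {y₀} = 3 := by
    rw [cutCount_contract_of_mem hY hy (by simp [hverts]) (by simp),
      Finset.union_eq_right.2 (by simpa using hy), hcut]
  rcases ih (contract G Y y₀) (by omega) (h3.contract hY hy) (by omega) (by
      rw [mem_contract_verts hY hy]
      by_cases hxY : x ∈ Y
      · exact Or.inr (hyx hxY).symm
      · exact Or.inl ⟨hx, hxY⟩) with hK' | hD | ⟨A, B, hA, hB, hAB⟩
  · refine absurd ?_ hK
    obtain ⟨y₁, h₁, y₂, h₂, y₃, h₃, n1, n2, n3, n4, n5, n6, hr⟩ := hK'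
    have hsub : ∀ v ∈ (contract G Y y₀).verts, v ∈ G.verts := by
      intro v hv
      rcases (mem_contract_verts hY hy).1 hv with h | rfl
      exacts [h.1, hY hy]
    exact ⟨y₁, hsub _ h₁, y₂, hsub _ h₂, y₃, hsub _ h₃, n1, n2, n3, n4, n5, n6,
      (route_contract h3 hY hy hb.1 hb.2 hcut).trans hr⟩
  · have := cutCount_even_of_isDoubledCycle hD {y₀}
    rw [hsingle] at this
    exact absurd this (by decide)
  · have key : ∀ {A B : Finset V}, A.card ≤ 2 → ((contract G Y y₀).verts \ B).card ≤ 2 →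
        SegTo (contract G Y y₀) A B → y₀ ∈ A → ∃ B, SegTo G Y B ∧ (G.verts \ B).card ≤ 2 := by
      intro A B hA hB hAB hyA
      have hlift := hAB.of_contract hY hy hyA
      refine ⟨B ∪ Y, SegTo.trans ?_ hlift, (Finset.card_le_card ?_).trans hB⟩
      · have hAe : (A.erase y₀).card ≤ 1 := by
          rw [Finset.card_erase_of_mem hyA]
          omega
        rcases Nat.le_one_iff_eq_zero_or_eq_one.1 hAe with h0 | h1
        · rw [Finset.card_eq_zero] at h0
          have : A ∪ Y = Y := Finset.union_eq_right.2 fun v hv => by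
            by_contra hvY
            have : v ∈ A.erase y₀ := Finset.mem_erase.2 ⟨fun h => hvY (h ▸ hy), hv⟩
            simp [h0] at this
          rw [this]
          exact .refl _ hY hcut
        · obtain ⟨a, ha⟩ := Finset.card_eq_one.1 h1
          have haA : a ∈ A.erase y₀ := by simp [ha]
          rw [Finset.mem_erase] at haA
          have : A ∪ Y = insert a Y := by
            rw [← Finset.insert_erase hyA, ha]
            ext v
            simp only [Finset.mem_union, Finset.mem_insert, Finset.mem_singleton]
            grind
          have haV := ((mem_contract_verts hY hy).1 (hAB.left.1 haA.2)).resolve_right haA.1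
          have h3' := hlift.left.2
          rw [this] at h3' ⊢
          exact .step a (.refl _ hY hcut) haV.1 haV.2 h3'
      · intro v hv
        simp only [Finset.mem_sdiff, Finset.mem_union, not_or] at hv
        exact Finset.mem_sdiff.2 ⟨(mem_contract_verts hY hy).2 (Or.inl ⟨hv.1, hv.2.2⟩), hv.2.1⟩
    by_cases hyB : y₀ ∈ B
    · exact key hA hB hAB (hAB.mem_of_cutCount_singleton hsingle hyB)
    · refine key hB ?_ hAB.compl ?_
      · rwa [Finset.sdiff_sdiff_eq_self hAB.left.1]
      · exact Finset.mem_sdiff.2 ⟨by simp [hverts], hyB⟩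

theorem hasK4At_or_structure (n : ℕ) : ∀ (G : MG V) (x : V), G.verts.card = n → ThreeConn G →
    4 ≤ G.verts.card → x ∈ G.verts → HasK4At G x ∨ IsDoubledCycle G ∨ HasSeg G := by
  induction n using Nat.strong_induction_on with
  | _ n ih =>
    intro G x hn h3 h4 hx
    by_cases hK : HasK4At G x
    · exact Or.inl hK
    by_cases hcore : ∀ X ⊆ G.verts, 2 ≤ X.card → 2 ≤ (G.verts \ X).card → 4 ≤ cutCount G.edges X
    · have hG : InternalCore G x := ⟨hx, h3, hcore, h4⟩
      exact hG.hasK4At_or_isDoubledCycle.imp_right Or.inl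
    · push Not at hcore
      obtain ⟨X, hX, hX2, hY2, hlt⟩ := hcore
      have hcut : cutCount G.edges X = 3 := by
        obtain ⟨a, ha⟩ := Finset.card_pos.1 (show 0 < X.card by omega)
        obtain ⟨b, hb⟩ := Finset.card_pos.1 (show 0 < (G.verts \ X).card by omega)
        rw [Finset.mem_sdiff] at hb
        have := h3 X hX a ha b hb.1 hb.2
        omega
      have ih' := fun (G' : MG V) h h3' h4' hx' =>
        ih G'.verts.card (hn ▸ h) G' x rfl h3' h4' hx'
      obtain ⟨B, hB, hB2⟩ := exists_segTo_of_contract h3 hx hK ih' hX hX2 hcut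
      obtain ⟨B', hB', hB2'⟩ := exists_segTo_of_contract h3 hx hK ih' (Y := G.verts \ X)
        Finset.sdiff_subset hY2 (by rwa [cutCount_compl G.edge_support])
      have hr := hB'.compl
      rw [Finset.sdiff_sdiff_eq_self hX] at hr
      exact Or.inr (Or.inr ⟨_, B, hB2', hB2, hr.trans hB⟩)

theorem IsWalk.exists_crosses {l : List V} {u v : V} (h : IsWalk l u v) {X : Finset V}
    (hne : ¬ (u ∈ X ↔ v ∈ X)) : ∃ e ∈ walkEdges l, Crosses X e := by
  obtain ⟨h1, h2⟩ := h
  induction l generalizing u with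
  | nil => simp at h1
  | cons a l ih =>
    obtain rfl : a = u := by simpa using h1
    cases l with
    | nil =>
      obtain rfl : a = v := by simpa using h2
      exact absurd Iff.rfl hne
    | cons b l =>
      rw [walkEdges_cons_cons]
      by_cases hab : a ∈ X ↔ b ∈ X
      · obtain ⟨e, he, hc⟩ := ih (u := b) (by rwa [← hab]) rfl (by simpa using h2)
        exact ⟨e, Multiset.mem_cons_of_mem he, hc⟩
      · exact ⟨_, Multiset.mem_cons_self _ _, by rw [crosses_mk]; tauto⟩

theorem sum_sum_filter_fst_eq {α : Type*} [Fintype α] [DecidableEq α] {M : Type*} [AddCommMonoid M]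
    {β : Type*} (P : Multiset (α × β)) (f : α × β → M) :
    ∑ e : α, ((P.filter fun p => p.1 = e).map f).sum = (P.map f).sum := by
  induction P using Multiset.induction_on with
  | empty => simp
  | cons p P ih =>
    rw [Multiset.map_cons, Multiset.sum_cons, ← ih]
    have : ∀ e : α, (((p ::ₘ P).filter fun p => p.1 = e).map f).sum =
        (if p.1 = e then f p else 0) + ((P.filter fun p => p.1 = e).map f).sum := by
      intro e
      rw [Multiset.filter_cons]
      split_ifs <;> simp
    simp only [this, Finset.sum_add_distrib, Finset.sum_ite_eq, Finset.mem_univ, if_true]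

/-- The edge sets of the six walks of an immersion of `K₄`. -/
theorem ImmersionVia.exists_walks {G : MG V} {φ : Fin 4 → V} (h : ImmersionVia G k4Edges φ) :
    ∃ w : Fin 4 → Fin 4 → Multiset (Sym2 V), (∀ i, w i i = 0) ∧ (∀ i j, w i j = w j i) ∧
      (∀ i j, i ≠ j → ∃ l, IsWalk l (φ i) (φ j) ∧ w i j = walkEdges l) ∧
      (∀ i j, w i j ≤ G.edges) ∧
      w 0 1 + w 0 2 + w 0 3 + w 1 2 + w 1 3 + w 2 3 ≤ G.edges := by
  obtain ⟨-, -, P, hP, hw, hle⟩ := h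
  set w : Sym2 (Fin 4) → Multiset (Sym2 V) := fun e =>
    ((P.filter fun p => p.1 = e).map fun p => walkEdges p.2).sum with hwdef
  have hcount : ∀ e, (P.filter fun p => p.1 = e).card = k4Edges.count e := by
    intro e
    rw [← hP, Multiset.count_map]
    simp only [eq_comm]
  refine ⟨fun i j => w s(i, j), fun i => ?_, fun i j => congrArg w Sym2.eq_swap, ?_, ?_, ?_⟩
  · have : (P.filter fun p => p.1 = s(i, i)) = 0 := by
      rw [← Multiset.card_eq_zero, hcount]
      revert i
      decide
    simp [hwdef, this]
  · intro i j hij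
    have h1 : (P.filter fun p => p.1 = s(i, j)).card = 1 := by
      rw [hcount]
      revert i j
      decide
    obtain ⟨p, hp⟩ := Multiset.card_eq_one.1 h1
    have hmem : p ∈ P.filter fun p => p.1 = s(i, j) := by simp [hp]
    rw [Multiset.mem_filter] at hmem
    obtain ⟨u, v, huv, hwalk⟩ := hw p hmem.1
    have hwe : w s(i, j) = walkEdges p.2 := by simp [hwdef, hp]
    rw [hmem.2, Sym2.eq_iff] at huv
    rcases huv with ⟨rfl, rfl⟩ | ⟨rfl, rfl⟩
    · exact ⟨_, hwalk, hwe⟩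
    · exact ⟨_, hwalk.reverse, hwe.trans (walkEdges_reverse _).symm⟩
  · intro i j
    refine le_trans ?_ hle
    rw [← sum_sum_filter_fst_eq]
    exact Finset.single_le_sum (f := w) (fun _ _ => Multiset.zero_le _) (Finset.mem_univ s(i, j))
  · refine le_trans ?_ hle
    rw [← sum_sum_filter_fst_eq]
    change _ ≤ ∑ e, w e
    refine le_trans (le_of_eq ?_) (Finset.sum_le_sum_of_subset (f := w)
      (Finset.subset_univ {s(0, 1), s(0, 2), s(0, 3), s(1, 2), s(1, 3), s(2, 3)}))
    rw [Finset.sum_insert (by decide), Finset.sum_insert (by decide), Finset.sum_insert (by decide),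
      Finset.sum_insert (by decide), Finset.sum_insert (by decide), Finset.sum_singleton]
    abel

theorem ImmersionVia.four_le_cutCount {G : MG V} {φ : Fin 4 → V} (h : ImmersionVia G k4Edges φ)
    {X : Finset V} (hX : (Finset.univ.filter fun i => φ i ∈ X).card = 2) :
    4 ≤ cutCount G.edges X := by
  obtain ⟨w, -, -, hw, -, hle⟩ := h.exists_walks
  have hc := cutCount_mono hle X
  have h1 : ∀ i j, i ≠ j → ¬ (φ i ∈ X ↔ φ j ∈ X) → 1 ≤ cutCount (w i j) X := by
    intro i j hij hX
    obtain ⟨l, hl, he⟩ := hw i j hij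
    rw [he]
    exact Multiset.countP_pos.2 (hl.exists_crosses hX)
  simp only [cutCount, Multiset.countP_add] at hc h1 ⊢
  have h01 := h1 0 1 (by decide)
  have h02 := h1 0 2 (by decide)
  have h03 := h1 0 3 (by decide)
  have h12 := h1 1 2 (by decide)
  have h13 := h1 1 3 (by decide)
  have h23 := h1 2 3 (by decide)
  rw [Finset.card_filter, Fin.sum_univ_four] at hX
  by_cases k0 : φ 0 ∈ X <;> by_cases k1 : φ 1 ∈ X <;> by_cases k2 : φ 2 ∈ X <;>
    by_cases k3 : φ 3 ∈ X <;>
    simp only [k0, k1, k2, k3, if_true, if_false, iff_true, iff_false,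
      not_true, not_false_iff, forall_true_left] at hX h01 h02 h03 h12 h13 h23 <;> omega

theorem not_immersionVia_of_hasSegmentation {G : MG V} {φ : Fin 4 → V} {X Y : Finset V}
    (hX : X.card ≤ 2) (hY : Y.card ≤ 2) (hs : HasSegmentation G X Y 3) :
    ¬ ImmersionVia G k4Edges φ := by
  intro h
  obtain ⟨n, C, ⟨hC, hstep, hd⟩, h0, hl⟩ := hs
  have hinj : ∀ S : Finset V, (Finset.univ.filter fun i => φ i ∈ S).card ≤ S.card := fun S =>
    Finset.card_le_card_of_injOn φ (fun i hi => by simpa using hi) h.1.injOn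
  have hne : ∀ i, (Finset.univ.filter fun j => φ j ∈ C i).card ≠ 2 := by
    intro i h2
    have := h.four_le_cutCount h2
    rw [← dcut_eq_cutCount, hd] at this
    omega
  have hle : ∀ i, (Finset.univ.filter fun j => φ j ∈ C i).card ≤ 1 := by
    intro i
    induction i using Fin.induction with
    | zero =>
      have := hinj (C 0)
      have := hne 0
      rw [h0] at *
      omega
    | succ i ih =>
      have h1 : (Finset.univ.filter fun j => φ j ∈ C i.succ).card ≤
          (Finset.univ.filter fun j => φ j ∈ C i.castSucc).card +
          (Finset.univ.filter fun j => φ j ∈ C i.succ \ C i.castSucc).card := by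
        refine le_trans (Finset.card_le_card ?_) (Finset.card_union_le _ _)
        intro j
        simp only [Finset.mem_filter, Finset.mem_union, Finset.mem_sdiff]
        tauto
      have h2 := hinj (C i.succ \ C i.castSucc)
      rw [(hstep i).2] at h2
      have := hne i.succ
      omega
  have hlast := hle (Fin.last n)
  have hY' := hinj (G.verts \ C (Fin.last n))
  rw [hl] at hY'
  have hsum : (Finset.univ : Finset (Fin 4)).card ≤
      (Finset.univ.filter fun j => φ j ∈ C (Fin.last n)).card +
      (Finset.univ.filter fun j => φ j ∈ Y).card := by
    refine le_trans (Finset.card_le_card ?_) (Finset.card_union_le _ _)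
    intro j
    have := h.2.1 j
    simp only [← hl, Finset.mem_filter, Finset.mem_union, Finset.mem_sdiff]
    tauto
  rw [Finset.card_univ, Fintype.card_fin] at hsum
  omega

/-- If six trails join four points of a circle pairwise, the arcs between the points cannot all be
used at most twice. -/
theorem false_of_arc_loads {U : Fin 4 → Fin 4 → Fin 4 → ℕ}
    (hload : ∀ t, U 0 1 t + U 0 2 t + U 0 3 t + U 1 2 t + U 1 3 t + U 2 3 t ≤ 2)
    (hsep : ∀ t m i j, t < m → ¬ ((t < i ∧ i ≤ m) ↔ (t < j ∧ j ≤ m)) → 1 ≤ U i j t + U i j m) :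
    False := by
  have h0 := hload 0
  have h1 := hload 1
  have h2 := hload 2
  have h3 := hload 3
  have a1 := hsep 0 1 0 1 (by decide) (by decide)
  have a2 := hsep 0 1 1 2 (by decide) (by decide)
  have a3 := hsep 0 1 1 3 (by decide) (by decide)
  have b1 := hsep 0 2 0 1 (by decide) (by decide)
  have b2 := hsep 0 2 0 2 (by decide) (by decide)
  have b3 := hsep 0 2 1 3 (by decide) (by decide)
  have b4 := hsep 0 2 2 3 (by decide) (by decide)
  have c1 := hsep 0 3 0 1 (by decide) (by decide)
  have c2 := hsep 0 3 0 2 (by decide) (by decide)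
  have c3 := hsep 0 3 0 3 (by decide) (by decide)
  have d1 := hsep 1 2 0 2 (by decide) (by decide)
  have d2 := hsep 1 2 1 2 (by decide) (by decide)
  have d3 := hsep 1 2 2 3 (by decide) (by decide)
  have e1 := hsep 1 3 0 2 (by decide) (by decide)
  have e2 := hsep 1 3 0 3 (by decide) (by decide)
  have e3 := hsep 1 3 1 2 (by decide) (by decide)
  have e4 := hsep 1 3 1 3 (by decide) (by decide)
  have f1 := hsep 2 3 0 3 (by decide) (by decide)
  have f2 := hsep 2 3 1 3 (by decide) (by decide)
  have f3 := hsep 2 3 2 3 (by decide) (by decide)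
  clear hload hsep
  rcases Nat.eq_zero_or_pos (U 0 2 0) with h | h <;>
  rcases Nat.eq_zero_or_pos (U 1 3 1) with h' | h' <;> linarith

theorem injective_cycleEdge {n : ℕ} (hn : 3 ≤ n) {f : Fin n → V} (hf : Function.Injective f) :
    Function.Injective fun i : Fin n =>
      s(f i, f ⟨(i.val + 1) % n, Nat.mod_lt _ i.pos⟩) := by
  intro i j hij
  rw [Sym2.eq_iff] at hij
  rcases hij with ⟨h, -⟩ | ⟨h1, h2⟩
  · exact hf h
  · have h1 := congrArg Fin.val (hf h1)
    have h2 := congrArg Fin.val (hf h2)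
    simp only at h1 h2
    have hi := i.2
    have hj := j.2
    have := Nat.mod_eq_sub_mod (a := i.val + 1) (b := n)
    rcases Nat.lt_or_ge (i.val + 1) n with hi' | hi'
    · rw [Nat.mod_eq_of_lt hi'] at h2
      rcases Nat.lt_or_ge (j.val + 1) n with hj' | hj'
      · rw [Nat.mod_eq_of_lt hj'] at h1
        omega
      · obtain hj'' : j.val + 1 = n := by omega
        rw [hj'', Nat.mod_self] at h1
        omega
    · obtain hi'' : i.val + 1 = n := by omega
      rw [hi'', Nat.mod_self] at h2
      rw [← h2, Nat.zero_add, Nat.mod_eq_of_lt (by omega)] at h1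
      omega

theorem cycleEdge_eq_of_crosses {n : ℕ} {f : Fin n → V} (hf : Function.Injective f)
    {p q i : Fin n} (hpq : p < q)
    (hc : Crosses ((Finset.univ.filter fun m => p < m ∧ m ≤ q).image f)
      s(f i, f ⟨(i.val + 1) % n, Nat.mod_lt _ i.pos⟩)) : i = p ∨ i = q := by
  rw [crosses_mk] at hc
  simp only [hf.mem_finset_image, Finset.mem_filter, Finset.mem_univ, true_and, Fin.lt_def,
    Fin.le_def] at hc
  simp only [Fin.ext_iff, Fin.lt_def] at hpq ⊢
  have hq := q.2
  rcases Nat.lt_or_ge (i.val + 1) n with hi' | hi'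
  · rw [Nat.mod_eq_of_lt hi'] at hc
    omega
  · obtain hi'' : i.val + 1 = n := by omega
    rw [hi'', Nat.mod_self] at hc
    omega

theorem not_immersionVia_of_isDoubledCycle {G : MG V} {φ : Fin 4 → V} (hG : IsDoubledCycle G) :
    ¬ ImmersionVia G k4Edges φ := by
  intro h
  obtain ⟨n, hn, f, hf, hverts, hedges⟩ := hG
  set g : Fin n → Sym2 V := fun i => s(f i, f ⟨(i.val + 1) % n, Nat.mod_lt _ i.pos⟩) with hg
  have hginj : Function.Injective g := injective_cycleEdge hn hf
  have hcyc : cycleEdges n f = Finset.univ.val.map g := rfl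
  have hk : ∀ i, ∃ a, f a = φ i := fun i => by
    have := h.2.1 i
    rw [← hverts] at this
    simpa using this
  choose k hk using hk
  have hkinj : Function.Injective k := fun i j hij => h.1 (by rw [← hk, ← hk, hij])
  set σ := Tuple.sort k with hσ
  set a : Fin 4 → Fin n := k ∘ σ with ha
  have hmono : StrictMono a :=
    (Tuple.monotone_sort k).strictMono_of_injective (hkinj.comp σ.injective)
  obtain ⟨w, hw0, hwsymm, hw, hwG, hle⟩ := h.exists_walks
  refine false_of_arc_loads (U := fun i j t => (w (σ i) (σ j)).count (g (a t))) ?_ ?_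
  · intro t
    have hcount : G.edges.count (g (a t)) ≤ 2 := by
      rw [hedges, Multiset.count_nsmul, hcyc, Multiset.count_map_eq_count' _ _ hginj]
      have := Multiset.nodup_iff_count_le_one.1 (Finset.univ : Finset (Fin n)).nodup (a t)
      omega
    have hcle := (Multiset.count_le_of_le (g (a t)) hle).trans hcount
    simp only [Multiset.count_add] at hcle
    set c : Fin 4 → Fin 4 → ℕ := fun i j => (w i j).count (g (a t)) with hc
    have hsum : ∑ i, ∑ j, c (σ i) (σ j) = ∑ i, ∑ j, c i j := by
      rw [← Equiv.sum_comp σ fun i => ∑ j, c i j]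
      exact Finset.sum_congr rfl fun i _ => Equiv.sum_comp σ (c (σ i))
    have hc0 : ∀ i, c i i = 0 := fun i => by simp [hc, hw0]
    have hcs : ∀ i j, c i j = c j i := fun i j => by simp only [hc, hwsymm i j]
    simp only [Fin.sum_univ_four, hc0, hcs 1 0, hcs 2 0, hcs 3 0, hcs 2 1, hcs 3 1, hcs 3 2,
      hcs (σ 1) (σ 0), hcs (σ 2) (σ 0), hcs (σ 3) (σ 0), hcs (σ 2) (σ 1), hcs (σ 3) (σ 1),
      hcs (σ 3) (σ 2)] at hsum
    change c 0 1 + c 0 2 + c 0 3 + c 1 2 + c 1 3 + c 2 3 ≤ 2 at hcle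
    change c (σ 0) (σ 1) + c (σ 0) (σ 2) + c (σ 0) (σ 3) + c (σ 1) (σ 2) + c (σ 1) (σ 3) +
      c (σ 2) (σ 3) ≤ 2
    omega
  · intro t m i j htm hsep
    have hij : i ≠ j := by
      rintro rfl
      exact hsep Iff.rfl
    obtain ⟨l, hl, hwl⟩ := hw (σ i) (σ j) (σ.injective.ne hij)
    set X := (Finset.univ.filter fun b => a t < b ∧ b ≤ a m).image f with hX
    have hmem : ∀ i, φ (σ i) ∈ X ↔ (t < i ∧ i ≤ m) := fun i => by
      rw [← hk, hX, hf.mem_finset_image]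
      simp only [Finset.mem_filter, Finset.mem_univ, true_and]
      exact and_congr hmono.lt_iff_lt hmono.le_iff_le
    obtain ⟨e, he, hcr⟩ := hl.exists_crosses (X := X) (by rwa [hmem, hmem])
    have heG : e ∈ G.edges := Multiset.mem_of_le (hwG _ _) (hwl ▸ he)
    rw [hedges, Multiset.mem_nsmul, hcyc, Multiset.mem_map] at heG
    obtain ⟨b, -, rfl⟩ := heG.2
    have hpos : 0 < (w (σ i) (σ j)).count (g b) := Multiset.count_pos.2 (hwl ▸ he)
    rcases cycleEdge_eq_of_crosses hf (hmono htm) hcr with rfl | rfl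
    · exact Nat.le_add_right_of_le hpos
    · exact Nat.le_add_left_of_le hpos

/-- Let `G` be a `3`-edge-connected graph with `|V(G)| ≥ 4` and with
at most one root vertex (the set `R` of roots has `|R| ≤ 1`).  Then `G` has no
(rooted) immersion of `K₄` if and only if either `G` is a doubled cycle, or `G` has a
`(2,2)`-segmentation of width three. -/
theorem statement_9 {V : Type} (G : MG V) (R : Finset V)
    (hR : R ⊆ G.verts) (hRcard : R.card ≤ 1)
    (h3 : EdgeConn G 3) (hcard : 4 ≤ G.verts.card) :
    ¬ (∃ φ : Fin 4 → V, ImmersionVia G k4Edges φ ∧ ∀ x ∈ R, ∃ i, φ i = x) ↔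
      (IsDoubledCycle G ∨
        ∃ X Y : Finset V, X.card ≤ 2 ∧ Y.card ≤ 2 ∧ HasSegmentation G X Y 3) := by
  constructor
  · intro hno
    obtain ⟨x, hx, hRx⟩ : ∃ x ∈ G.verts, ∀ y ∈ R, x = y := by
      rcases R.eq_empty_or_nonempty with rfl | ⟨x, hx⟩
      · obtain ⟨x, hx⟩ := Finset.card_pos.1 (by omega : 0 < G.verts.card)
        exact ⟨x, hx, by simp⟩
      · exact ⟨x, hR hx, fun y hy => Finset.card_le_one.1 hRcard x hx y hy⟩
    have hconn : ThreeConn G := by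
      intro X hX a ha b hb hbX
      rw [← dcut_eq_cutCount]
      exact h3 X hX ⟨a, ha⟩ (by rintro rfl; exact hbX hb)
    rcases hasK4At_or_structure _ G x rfl hconn hcard hx with hK | hD | ⟨A, B, hA, hB, hAB⟩
    · obtain ⟨φ, hφ, h0⟩ := hK.exists_immersionVia hx
      exact absurd ⟨φ, hφ, fun y hy => ⟨0, h0.trans (hRx y hy)⟩⟩ hno
    · exact Or.inl hD
    · exact Or.inr ⟨A, _, hA, hB, hAB.hasSegmentation⟩
  · rintro (hD | ⟨X, Y, hX, hY, hs⟩) ⟨φ, hφ, -⟩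
    · exact not_immersionVia_of_isDoubledCycle hD hφ
    · exact not_immersionVia_of_hasSegmentation hX hY hs hφ

end PaperW4
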